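/- arXiv:1501.02537 — 12 statements merged into one kernel-verified Lean document; each statement's English description precedes it below -/
import Mathlib

section
/- Let H be an infinite-dimensional separable complex Hilbert space and T a bounded linear operator on H. If there exist a strictly increasing sequence of positive integers (n_k), two dense subsets X, Y of H, and a sequence of maps S_{n_k} : Y → H such that (1) ‖T^{n_k}x‖·‖S_{n_k}y‖ → 0 as k → ∞ for all x ∈ X and y ∈ Y, (2) ‖S_{n_k}y‖ → 0 as k → ∞ for all y ∈ Y, and (3) T^{n_k}S_{n_k}y → y as k → ∞ for all y ∈ Y, then T has a diskcyclic vector. -/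
open Filter Topology

/-- `x` is a diskcyclic vector for `T`: the disk orbit
`{α • T^n x : n ≥ 0, α ∈ ℂ, |α| ≤ 1}` is dense. -/
def IsDiskcyclicVector {H : Type*} [NormedAddCommGroup H] [NormedSpace ℂ H]
    (T : H →L[ℂ] H) (x : H) : Prop :=
  Dense {y : H | ∃ (n : ℕ) (α : ℂ), ‖α‖ ≤ 1 ∧ y = α • (T ^ n) x}

/-- `T` is diskcyclic: it has a diskcyclic vector. -/
def IsDiskcyclic {H : Type*} [NormedAddCommGroup H] [NormedSpace ℂ H]
    (T : H →L[ℂ] H) : Prop :=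
  ∃ x, IsDiskcyclicVector T x

/-- `x` is a hypercyclic vector for `T`: the orbit `{T^n x : n ≥ 0}` is dense. -/
def IsHypercyclicVector {H : Type*} [NormedAddCommGroup H] [NormedSpace ℂ H]
    (T : H →L[ℂ] H) (x : H) : Prop :=
  Dense {y : H | ∃ n : ℕ, y = (T ^ n) x}

/-- `T` is hypercyclic: it has a hypercyclic vector. -/
def IsHypercyclic {H : Type*} [NormedAddCommGroup H] [NormedSpace ℂ H]
    (T : H →L[ℂ] H) : Prop :=
  ∃ x, IsHypercyclicVector T x

/-- Birkhoff-type transitivity theorem for disk orbits. -/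
theorem exists_isDiskcyclicVector_of_transitive {H : Type*} [NormedAddCommGroup H]
    [NormedSpace ℂ H] [CompleteSpace H] [TopologicalSpace.SeparableSpace H] (T : H →L[ℂ] H)
    (hT : ∀ U V : Set H, IsOpen U → U.Nonempty → IsOpen V → V.Nonempty →
      ∃ z ∈ U, ∃ (m : ℕ) (α : ℂ), ‖α‖ ≤ 1 ∧ α • (T ^ m) z ∈ V) :
    ∃ x : H, IsDiskcyclicVector T x := by
  have : SecondCountableTopology H := UniformSpace.secondCountable_of_separable H
  obtain ⟨B, hBc, hBe, hB⟩ := TopologicalSpace.exists_countable_basis H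
  let G : Set H → Set H := fun V => {z | ∃ (m : ℕ) (α : ℂ), ‖α‖ ≤ 1 ∧ α • (T ^ m) z ∈ V}
  have hG_open : ∀ V ∈ B, IsOpen (G V) := by
    intro V hV
    have hG : G V = ⋃ (m : ℕ) (α : ℂ) (_ : ‖α‖ ≤ 1), (fun z => α • (T ^ m) z) ⁻¹' V := by
      ext z
      simp [G]
    rw [hG]
    exact isOpen_iUnion fun m => isOpen_iUnion fun α => isOpen_iUnion fun _ =>
      (hB.isOpen hV).preimage (((T ^ m).continuous).const_smul α)
  have hG_dense : ∀ V ∈ B, Dense (G V) := by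
    intro V hV
    rw [dense_iff_inter_open]
    intro U hU hUne
    obtain ⟨z, hzU, hz⟩ :=
      hT U V hU hUne (hB.isOpen hV) (Set.nonempty_iff_ne_empty.2 fun h => hBe (h ▸ hV))
    exact ⟨z, hzU, hz⟩
  obtain ⟨x, hx⟩ := (dense_biInter_of_isOpen hG_open hBc hG_dense).nonempty
  refine ⟨x, hB.dense_iff.2 fun V hV _ => ?_⟩
  obtain ⟨m, α, hα, hmem⟩ := Set.mem_iInter₂.1 hx V hV
  exact ⟨_, hmem, m, α, hα, rfl⟩

/-- Diskcyclic Criterion: the three conditions imply existence of a diskcyclic vector. -/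
theorem diskcyclic_criterion {H : Type*} [NormedAddCommGroup H] [InnerProductSpace ℂ H]
    [CompleteSpace H] [TopologicalSpace.SeparableSpace H]
    (h_inf : ¬ FiniteDimensional ℂ H)
    (T : H →L[ℂ] H) (n : ℕ → ℕ) (hmono : StrictMono n) (hpos : ∀ k, 0 < n k)
    (X Y : Set H) (hX : Dense X) (hY : Dense Y) (S : ℕ → H → H)
    (h1 : ∀ x ∈ X, ∀ y ∈ Y,
      Tendsto (fun k => ‖(T ^ (n k)) x‖ * ‖S k y‖) atTop (𝓝 0))
    (h2 : ∀ y ∈ Y, Tendsto (fun k => ‖S k y‖) atTop (𝓝 0))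
    (h3 : ∀ y ∈ Y, Tendsto (fun k => (T ^ (n k)) (S k y)) atTop (𝓝 y)) :
    ∃ x : H, IsDiskcyclicVector T x := by
  refine exists_isDiskcyclicVector_of_transitive T fun U V hU hUne hV hVne => ?_
  obtain ⟨x, hxU, hxX⟩ := hX.inter_open_nonempty U hU hUne
  obtain ⟨y, hyV, hyY⟩ := hY.inter_open_nonempty V hV hVne
  obtain ⟨r, hr, hrV⟩ := Metric.isOpen_iff.1 hV y hyV
  obtain ⟨ε, hε, hε1, hεr⟩ : ∃ ε : ℝ, 0 < ε ∧ ε ≤ 1 ∧ ε ≤ r / 2 :=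
    ⟨min 1 (r / 2), by positivity, min_le_left _ _, min_le_right _ _⟩
  let c : ℕ → ℝ := fun k => ε / (1 + ‖(T ^ n k) x‖)
  have hc : ∀ k, 0 < c k := fun k => by positivity
  have hc1 : ∀ k, c k ≤ 1 := fun k =>
    div_le_one_of_le₀ (by linarith [norm_nonneg ((T ^ n k) x)]) (by positivity)
  have hcT : ∀ k, c k * ‖(T ^ n k) x‖ ≤ r / 2 := fun k => by
    refine le_trans ?_ hεr
    rw [div_mul_eq_mul_div, div_le_iff₀ (by positivity)]
    nlinarith
  have hS : Tendsto (fun k => ((c k : ℂ)⁻¹) • S k y) atTop (𝓝 0) := by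
    rw [tendsto_zero_iff_norm_tendsto_zero]
    have h := ((h2 y hyY).add (h1 x hxX y hyY)).const_mul ε⁻¹
    rw [add_zero, mul_zero] at h
    refine h.congr fun k => ?_
    rw [norm_smul, norm_inv, Complex.norm_real, Real.norm_of_nonneg (hc k).le, inv_div]
    ring
  have hz : Tendsto (fun k => x + ((c k : ℂ)⁻¹) • S k y) atTop (𝓝 x) := by
    simpa using hS.const_add x
  obtain ⟨k, hkU, hkV⟩ := ((hz.eventually (hU.mem_nhds hxU)).and
    ((h3 y hyY).eventually (Metric.ball_mem_nhds y (half_pos hr)))).exists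
  have hck : (c k : ℂ) ≠ 0 := Complex.ofReal_ne_zero.2 (hc k).ne'
  have hnorm : ‖(c k : ℂ)‖ = c k := by
    rw [Complex.norm_real, Real.norm_of_nonneg (hc k).le]
  refine ⟨_, hkU, n k, c k, hnorm.trans_le (hc1 k), hrV ?_⟩
  rw [map_add, map_smul, smul_add, smul_inv_smul₀ hck, mem_ball_iff_norm, add_sub_assoc]
  rw [dist_eq_norm] at hkV
  have hle := norm_add_le ((c k : ℂ) • (T ^ n k) x) ((T ^ n k) (S k y) - y)
  rw [norm_smul, hnorm] at hle
  linarith [hcT k]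
end

section
/- Let T and S be bounded linear operators on a complex Hilbert space H such that ST = TS and the range of S is dense in H. If x is a diskcyclic vector for T, then Sx is a diskcyclic vector for T. -/
open Filter Topology

/-- If `S` commutes with `T` and has dense range, then `S` maps diskcyclic vectors of `T`
to diskcyclic vectors of `T`. -/
theorem smul_diskcyclicVector_of_commute_denseRange {H : Type*} [NormedAddCommGroup H]
    [InnerProductSpace ℂ H] [CompleteSpace H]
    (T S : H →L[ℂ] H) (hcomm : S ∘L T = T ∘L S) (hrange : DenseRange S)
    (x : H) (hx : IsDiskcyclicVector T x) :
    IsDiskcyclicVector T (S x) := by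
  refine (hrange.dense_image S.continuous hx).mono ?_
  rintro _ ⟨_, ⟨n, α, hα, rfl⟩, rfl⟩
  have hpow : Commute S (T ^ n) := Commute.pow_right hcomm n
  exact ⟨n, α, hα, (map_smul S α _).trans (congrArg (α • ·) (DFunLike.congr_fun hpow.eq x))⟩
end

section
/- Let T be a bounded linear operator on a complex Hilbert space H. If x is a diskcyclic vector for T, then T^n x is also a diskcyclic vector for T for every n ∈ ℕ. -/
open Filter Topology

/-- The image of a diskcyclic vector is diskcyclic: vectors of norm greater than `‖x‖` are limits of
the disk orbit of `T x`, and the closure of that disk orbit is stable under contraction. -/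
theorem IsDiskcyclicVector.apply {H : Type*} [NormedAddCommGroup H] [NormedSpace ℂ H]
    {T : H →L[ℂ] H} {x : H} (hx : IsDiskcyclicVector T x) : IsDiskcyclicVector T (T x) := by
  intro y
  rcases eq_or_ne y 0 with rfl | hy
  · exact subset_closure ⟨0, 0, by simp, by simp⟩
  obtain ⟨k, hk⟩ := exists_nat_gt (‖x‖ / ‖y‖)
  have hk0 : 0 < k := Nat.cast_pos.mp ((by positivity : 0 ≤ ‖x‖ / ‖y‖).trans_lt hk)
  have hk1 : (1 : ℝ) ≤ k := by exact_mod_cast hk0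
  have hlarge : (k : ℂ) • y ∈ {z : H | ‖x‖ < ‖z‖} := by
    rw [Set.mem_ofPred_eq, norm_smul, Complex.norm_natCast]
    exact (div_lt_iff₀ (norm_pos_iff.mpr hy)).mp hk
  have hmem := hx.open_subset_closure_inter (isOpen_lt continuous_const continuous_norm) hlarge
  have hcontr := map_mem_closure (continuous_const_smul (k : ℂ)⁻¹) hmem
    (t := {y : H | ∃ (n : ℕ) (α : ℂ), ‖α‖ ≤ 1 ∧ y = α • (T ^ n) (T x)}) ?_
  · rwa [inv_smul_smul₀ (Nat.cast_ne_zero.mpr hk0.ne')] at hcontr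
  rintro _ ⟨hz, n, α, hα, rfl⟩
  cases n with
  | zero =>
    rw [Set.mem_ofPred_eq, pow_zero, one_apply_eq_self, norm_smul] at hz
    exact absurd hz (not_lt.mpr (mul_le_of_le_one_left (norm_nonneg x) hα))
  | succ m =>
    refine ⟨m, (k : ℂ)⁻¹ * α, ?_, ?_⟩
    · rw [norm_mul, norm_inv, Complex.norm_natCast]
      exact mul_le_one₀ (inv_le_one_of_one_le₀ hk1) (norm_nonneg α) hα
    · rw [pow_succ, mul_smul, mul_apply_eq_comp]

/-- If `x` is a diskcyclic vector for `T`, then so is `T^n x` for every `n`. -/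
theorem pow_apply_diskcyclicVector {H : Type*} [NormedAddCommGroup H]
    [InnerProductSpace ℂ H] [CompleteSpace H]
    (T : H →L[ℂ] H) (x : H) (hx : IsDiskcyclicVector T x) (n : ℕ) :
    IsDiskcyclicVector T ((T ^ n) x) := by
  induction n with
  | zero => simpa using hx
  | succ m ih =>
    rw [pow_succ', mul_apply_eq_comp]
    exact ih.apply
end

section
/- If T is a diskcyclic bounded linear operator on a complex Hilbert space H, then the set DC(T) of all diskcyclic vectors for T is dense in H. -/
open Filter Topology

/-- A nonzero multiple of a diskcyclic vector is diskcyclic. -/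
theorem IsDiskcyclicVector.smul {H : Type*} [NormedAddCommGroup H] [NormedSpace ℂ H]
    {T : H →L[ℂ] H} {x : H} (hx : IsDiskcyclicVector T x) {c : ℂ} (hc : c ≠ 0) :
    IsDiskcyclicVector T (c • x) := by
  have hsurj : Function.Surjective fun y : H => c • y := fun y => ⟨c⁻¹ • y, smul_inv_smul₀ hc y⟩
  refine (hsurj.denseRange.dense_image (continuous_const_smul c) hx).mono ?_
  rintro _ ⟨_, ⟨n, α, hα, rfl⟩, rfl⟩
  exact ⟨n, α, hα, by simp only [map_smul, smul_comm c α]⟩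

/-- If `x` is diskcyclic for `T` and `T x ≠ 0`, then `T x` is diskcyclic. -/
theorem IsDiskcyclicVector.map {H : Type*} [NormedAddCommGroup H] [NormedSpace ℂ H]
    {T : H →L[ℂ] H} {x : H} (hx : IsDiskcyclicVector T x) (hTx : T x ≠ 0) :
    IsDiskcyclicVector T (T x) := by
  by_cases htop : Submodule.span ℂ {x} = ⊤
  · obtain ⟨c, hc⟩ := Submodule.mem_span_singleton.1 (htop ▸ Submodule.mem_top : T x ∈ _)
    rw [← hc]
    refine hx.smul ?_
    rintro rfl
    exact hTx (by simpa using hc.symm)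
  · have hclosed : IsClosed (Submodule.span ℂ {x} : Set H) :=
      Submodule.closed_of_finiteDimensional _
    have hdense : Dense (Submodule.span ℂ {x} : Set H)ᶜ := by
      rw [← interior_eq_empty_iff_dense_compl, ← Set.not_nonempty_iff_eq_empty]
      exact fun h => htop (Submodule.eq_top_of_nonempty_interior' _ h)
    refine (Dense.inter_of_isOpen_right hx hdense hclosed.isOpen_compl).mono ?_
    rintro _ ⟨⟨n, α, hα, rfl⟩, hn⟩
    cases n with
    | zero => exact absurd (Submodule.mem_span_singleton.2 ⟨α, by simp⟩) hn
    | succ n => exact ⟨n, α, hα, by rw [pow_succ, mul_apply_eq_comp]⟩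

/-- If `x` is diskcyclic for `T` and `T ^ n x ≠ 0`, then `T ^ n x` is diskcyclic. -/
theorem IsDiskcyclicVector.map_pow {H : Type*} [NormedAddCommGroup H] [NormedSpace ℂ H]
    {T : H →L[ℂ] H} {x : H} (hx : IsDiskcyclicVector T x) (n : ℕ) (hn : (T ^ n) x ≠ 0) :
    IsDiskcyclicVector T ((T ^ n) x) := by
  induction n with
  | zero => simpa using hx
  | succ n ih =>
    rw [pow_succ', mul_apply_eq_comp] at hn ⊢
    exact (ih fun h => hn (by rw [h, map_zero])).map hn

/-- If `T` is diskcyclic, then the set of diskcyclic vectors for `T` is dense. -/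
theorem dense_diskcyclicVectors {H : Type*} [NormedAddCommGroup H]
    [InnerProductSpace ℂ H] [CompleteSpace H]
    (T : H →L[ℂ] H) (hT : IsDiskcyclic T) :
    Dense {x : H | IsDiskcyclicVector T x} := by
  obtain ⟨x, hx⟩ := hT
  rcases subsingleton_or_nontrivial H with hH | hH
  · exact hx.mono fun y _ => Subsingleton.elim x y ▸ hx
  · refine (Dense.sdiff_singleton hx 0).mono ?_
    rintro _ ⟨⟨n, α, -, rfl⟩, hy⟩
    obtain ⟨hα, hn⟩ := smul_ne_zero_iff.1 hy
    exact (hx.map_pow n hn).smul hα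
end

section
/- Let T be a diskcyclic bounded linear operator on an infinite-dimensional separable complex Hilbert space H. Then the adjoint T* has at most one eigenvalue (i.e., any two eigenvalues of T* are equal), and every eigenvalue λ of T* satisfies |λ| > 1. -/
open Filter Topology

section AdjointEigenvectors

variable {H : Type*} [NormedAddCommGroup H] [InnerProductSpace ℂ H]

theorem IsDiskcyclicVector.forall_of_isClosed {T : H →L[ℂ] H} {x : H}
    (hx : IsDiskcyclicVector T x) {p : H → Prop} (hp : IsClosed {y | p y})
    (h : ∀ (n : ℕ) (α : ℂ), ‖α‖ ≤ 1 → p (α • (T ^ n) x)) (y : H) : p y := by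
  refine hp.closure_subset_iff.mpr ?_ (hx y)
  rintro _ ⟨n, α, hα, rfl⟩
  exact h n α hα

variable [CompleteSpace H]

theorem inner_pow_apply_of_adjoint_apply_eq_smul {T : H →L[ℂ] H} {v : H} {l : ℂ}
    (hv : ContinuousLinearMap.adjoint T v = l • v) (n : ℕ) (x : H) :
    inner ℂ v ((T ^ n) x) = (starRingEnd ℂ l) ^ n * inner ℂ v x := by
  induction n with
  | zero => simp
  | succ n ih =>
    rw [pow_succ', mul_apply_eq_comp, ← ContinuousLinearMap.adjoint_inner_left, hv,
      inner_smul_left, ih, pow_succ', mul_assoc]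

theorem norm_inner_smul_pow_apply_of_adjoint_apply_eq_smul {T : H →L[ℂ] H} {v : H} {l : ℂ}
    (hv : ContinuousLinearMap.adjoint T v = l • v) (n : ℕ) (α : ℂ) (x : H) :
    ‖inner ℂ v (α • (T ^ n) x)‖ = ‖α‖ * (‖l‖ ^ n * ‖inner ℂ v x‖) := by
  rw [inner_smul_right, inner_pow_apply_of_adjoint_apply_eq_smul hv, norm_mul, norm_mul, norm_pow,
    RCLike.norm_conj]

theorem IsDiskcyclicVector.one_lt_norm_of_adjoint_apply_eq_smul {T : H →L[ℂ] H} {x : H}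
    (hx : IsDiskcyclicVector T x) {v : H} {l : ℂ} (hv0 : v ≠ 0)
    (hv : ContinuousLinearMap.adjoint T v = l • v) : 1 < ‖l‖ := by
  by_contra! hl
  have bound : ∀ y, ‖inner ℂ v y‖ ≤ ‖inner ℂ v x‖ := by
    refine hx.forall_of_isClosed (isClosed_le (by fun_prop) (by fun_prop)) fun n α hα => ?_
    rw [norm_inner_smul_pow_apply_of_adjoint_apply_eq_smul hv, ← mul_assoc]
    exact mul_le_of_le_one_left (norm_nonneg _)
      (mul_le_one₀ hα (by positivity) (pow_le_one₀ (norm_nonneg _) hl))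
  have h := bound (((‖inner ℂ v x‖ + 1 : ℝ) / inner ℂ v v : ℂ) • v)
  rw [inner_smul_right, div_mul_cancel₀ _ (inner_self_ne_zero.mpr hv0), Complex.norm_real,
    Real.norm_of_nonneg (by positivity)] at h
  linarith

theorem IsDiskcyclicVector.inner_ne_zero_of_adjoint_apply_eq_smul {T : H →L[ℂ] H} {x : H}
    (hx : IsDiskcyclicVector T x) {v : H} {l : ℂ} (hv0 : v ≠ 0)
    (hv : ContinuousLinearMap.adjoint T v = l • v) : inner ℂ v x ≠ 0 := by
  intro h0
  have hall : ∀ y, inner ℂ v y = 0 := by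
    refine hx.forall_of_isClosed (isClosed_eq (by fun_prop) (by fun_prop)) fun n α _ => ?_
    rw [inner_smul_right, inner_pow_apply_of_adjoint_apply_eq_smul hv, h0, mul_zero, mul_zero]
  exact hv0 (inner_self_eq_zero.mp (hall v))

theorem IsDiskcyclicVector.eq_of_adjoint_apply_eq_smul {T : H →L[ℂ] H} {x : H}
    (hx : IsDiskcyclicVector T x) {u v : H} {a b : ℂ} (hu0 : u ≠ 0) (hv0 : v ≠ 0)
    (hu : ContinuousLinearMap.adjoint T u = a • u)
    (hv : ContinuousLinearMap.adjoint T v = b • v) (hab : ‖a‖ ≤ ‖b‖) : a = b := by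
  have bound : ∀ y, ‖inner ℂ u y‖ * ‖inner ℂ v x‖ ≤ ‖inner ℂ v y‖ * ‖inner ℂ u x‖ := by
    refine hx.forall_of_isClosed (isClosed_le (by fun_prop) (by fun_prop)) fun n α _ => ?_
    rw [norm_inner_smul_pow_apply_of_adjoint_apply_eq_smul hu,
      norm_inner_smul_pow_apply_of_adjoint_apply_eq_smul hv]
    calc ‖α‖ * (‖a‖ ^ n * ‖inner ℂ u x‖) * ‖inner ℂ v x‖
        ≤ ‖α‖ * (‖b‖ ^ n * ‖inner ℂ u x‖) * ‖inner ℂ v x‖ := by gcongr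
      _ = ‖α‖ * (‖b‖ ^ n * ‖inner ℂ v x‖) * ‖inner ℂ u x‖ := by ring
  have hker : ∀ y, inner ℂ v y = 0 → inner ℂ u y = 0 := by
    intro y hy
    have h := bound y
    rw [hy, norm_zero, zero_mul] at h
    have hpos := norm_pos_iff.mpr (hx.inner_ne_zero_of_adjoint_apply_eq_smul hv0 hv)
    exact norm_le_zero_iff.mp (nonpos_of_mul_nonpos_left h hpos)
  obtain ⟨c, hc⟩ : ∃ c : ℂ, u = c • v := by
    refine ⟨inner ℂ v u / inner ℂ v v, sub_eq_zero.mp ?_⟩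
    set w := u - (inner ℂ v u / inner ℂ v v) • v with hw
    have hvw : inner ℂ v w = 0 := by
      rw [hw, inner_sub_right, inner_smul_right,
        div_mul_cancel₀ _ (inner_self_ne_zero.mpr hv0), sub_self]
    refine inner_self_eq_zero (𝕜 := ℂ).mp ?_
    nth_rewrite 1 [hw]
    rw [inner_sub_left, inner_smul_left, hvw, hker w hvw, mul_zero, sub_zero]
  refine smul_left_injective ℂ hu0 ?_
  change a • u = b • u
  rw [← hu, hc, map_smul, hv, smul_comm]

end AdjointEigenvectors

/-- If `T` is diskcyclic, then `T*` has at most one eigenvalue, and every eigenvalue of `T*`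
has modulus greater than `1`. -/
theorem adjoint_eigenvalue_of_diskcyclic {H : Type*} [NormedAddCommGroup H]
    [InnerProductSpace ℂ H] [CompleteSpace H] [TopologicalSpace.SeparableSpace H]
    (h_inf : ¬ FiniteDimensional ℂ H)
    (T : H →L[ℂ] H) (hT : IsDiskcyclic T) :
    (∀ l₁ l₂ : ℂ,
        (∃ v : H, v ≠ 0 ∧ ContinuousLinearMap.adjoint T v = l₁ • v) →
        (∃ v : H, v ≠ 0 ∧ ContinuousLinearMap.adjoint T v = l₂ • v) → l₁ = l₂) ∧
    (∀ l : ℂ, (∃ v : H, v ≠ 0 ∧ ContinuousLinearMap.adjoint T v = l • v) → 1 < ‖l‖) := by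
  obtain ⟨x, hx⟩ := hT
  refine ⟨?_, fun l ⟨v, hv0, hv⟩ => hx.one_lt_norm_of_adjoint_apply_eq_smul hv0 hv⟩
  rintro a b ⟨u, hu0, hu⟩ ⟨v, hv0, hv⟩
  rcases le_total ‖a‖ ‖b‖ with h | h
  · exact hx.eq_of_adjoint_apply_eq_smul hu0 hv0 hu hv h
  · exact (hx.eq_of_adjoint_apply_eq_smul hv0 hu0 hv hu h).symm
end

section
/- Let B be the unilateral backward shift on the complex Hilbert space ℓ²(ℕ), i.e., the bounded linear operator defined by (Bx)(n) = x(n+1) for all n ∈ ℕ, and let λ ∈ ℂ. Then λB is hypercyclic if and only if λB is diskcyclic. -/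
open Filter Topology

theorem IsHypercyclic.isDiskcyclic {H : Type*} [NormedAddCommGroup H] [NormedSpace ℂ H]
    {T : H →L[ℂ] H} (hT : IsHypercyclic T) : IsDiskcyclic T := by
  obtain ⟨x, hx⟩ := hT
  refine ⟨x, hx.mono ?_⟩
  rintro y ⟨n, rfl⟩
  exact ⟨n, 1, by simp, by simp⟩

theorem IsDiskcyclic.separableSpace {H : Type*} [NormedAddCommGroup H] [NormedSpace ℂ H]
    {T : H →L[ℂ] H} (hT : IsDiskcyclic T) : TopologicalSpace.SeparableSpace H := by
  obtain ⟨x, hx⟩ := hT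
  have hsep : TopologicalSpace.IsSeparable
      (⋃ n : ℕ, Set.range fun α : ℂ => α • (T ^ n) x) :=
    .iUnion fun n => TopologicalSpace.isSeparable_range (by fun_prop)
  rw [← TopologicalSpace.isSeparable_univ_iff, ← hx.closure_eq]
  refine (hsep.mono ?_).closure
  rintro y ⟨n, α, -, rfl⟩
  exact Set.mem_iUnion.2 ⟨n, α, rfl⟩

/-- A diskcyclic operator on a nontrivial space is not a contraction. -/
theorem IsDiskcyclic.one_lt_norm {H : Type*} [NormedAddCommGroup H] [NormedSpace ℂ H]
    [Nontrivial H] {T : H →L[ℂ] H} (hT : IsDiskcyclic T) : 1 < ‖T‖ := by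
  by_contra! h
  obtain ⟨x, hx⟩ := hT
  have hsub : {y : H | ∃ (n : ℕ) (α : ℂ), ‖α‖ ≤ 1 ∧ y = α • (T ^ n) x} ⊆
      Metric.closedBall 0 ‖x‖ := by
    rintro y ⟨n, α, hα, rfl⟩
    rw [mem_closedBall_zero_iff, norm_smul]
    calc ‖α‖ * ‖(T ^ n) x‖ ≤ 1 * (1 * ‖x‖) := by
          gcongr
          refine (T ^ n).le_of_opNorm_le ?_ x
          exact (norm_pow_le T n).trans (pow_le_one₀ (norm_nonneg _) h)
      _ = ‖x‖ := by ring
  obtain ⟨z, hz⟩ := NormedSpace.exists_lt_norm ℂ H ‖x‖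
  have := closure_minimal hsub Metric.isClosed_closedBall (hx z)
  rw [mem_closedBall_zero_iff] at this
  linarith

/-- Birkhoff's transitivity theorem. -/
theorem IsHypercyclic.of_transitive {H : Type*} [NormedAddCommGroup H] [NormedSpace ℂ H]
    [CompleteSpace H] [TopologicalSpace.SeparableSpace H] {T : H →L[ℂ] H}
    (hT : ∀ U V : Set H, IsOpen U → IsOpen V → U.Nonempty → V.Nonempty →
      ∃ n : ℕ, ∃ x ∈ U, (T ^ n) x ∈ V) : IsHypercyclic T := by
  have := UniformSpace.secondCountable_of_separable H
  have hb := TopologicalSpace.isBasis_countableBasis H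
  have hdense : Dense (⋂ V ∈ TopologicalSpace.countableBasis H,
      ⋃ n : ℕ, (fun x => (T ^ n) x) ⁻¹' V) := by
    refine dense_biInter_of_isOpen (fun V hV => ?_)
      (TopologicalSpace.countable_countableBasis H) fun V hV => ?_
    · exact isOpen_iUnion fun n => (hb.isOpen hV).preimage (T ^ n).continuous
    · refine dense_iff_inter_open.2 fun U hU hne => ?_
      obtain ⟨n, x, hx, hxV⟩ := hT U V hU (hb.isOpen hV) hne
        (TopologicalSpace.nonempty_of_mem_countableBasis hV)
      exact ⟨x, hx, Set.mem_iUnion.2 ⟨n, hxV⟩⟩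
  obtain ⟨x, hx⟩ := hdense.nonempty
  refine ⟨x, hb.dense_iff.2 fun V hV _ => ?_⟩
  obtain ⟨n, hn⟩ := Set.mem_iUnion.1 (Set.mem_iInter₂.1 hx V hV)
  exact ⟨_, hn, n, rfl⟩

section BackwardShift

variable {B : lp (fun _ : ℕ => ℂ) 2 →L[ℂ] lp (fun _ : ℕ => ℂ) 2}

theorem norm_backwardShift_le (hB : ∀ (x : lp (fun _ : ℕ => ℂ) 2) (n : ℕ), B x n = x (n + 1)) :
    ‖B‖ ≤ 1 := by
  refine B.opNorm_le_bound zero_le_one fun x => ?_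
  rw [one_mul]
  refine lp.norm_le_of_forall_sum_le (by norm_num) (norm_nonneg x) fun s => ?_
  simpa [hB] using lp.sum_rpow_le_norm_rpow (p := 2) (by norm_num) x
    (s.map ⟨fun n : ℕ => n + 1, add_left_injective 1⟩)

theorem backwardShift_pow_apply
    (hB : ∀ (x : lp (fun _ : ℕ => ℂ) 2) (n : ℕ), B x n = x (n + 1))
    (m : ℕ) (x : lp (fun _ : ℕ => ℂ) 2) (n : ℕ) : (B ^ m) x n = x (n + m) := by
  induction m generalizing n with
  | zero => simp
  | succ m ih =>
    rw [pow_succ', mul_apply_eq_comp, hB, ih, add_right_comm, add_assoc]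

theorem backwardShift_pow_single_add
    (hB : ∀ (x : lp (fun _ : ℕ => ℂ) 2) (n : ℕ), B x n = x (n + 1)) (m i : ℕ) (a : ℂ) :
    (B ^ m) (lp.single 2 (i + m) a) = lp.single 2 i a := by
  ext n
  rw [backwardShift_pow_apply hB]
  simp [lp.single_apply, Pi.single_apply]

theorem backwardShift_pow_single_of_lt
    (hB : ∀ (x : lp (fun _ : ℕ => ℂ) 2) (n : ℕ), B x n = x (n + 1)) {m i : ℕ} (h : i < m)
    (a : ℂ) : (B ^ m) (lp.single 2 i a) = 0 := by
  ext n
  have : n + m ≠ i := by omega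
  rw [backwardShift_pow_apply hB]
  simp [lp.single_apply, this]

theorem exists_sum_single_mem {U : Set (lp (fun _ : ℕ => ℂ) 2)} (hU : IsOpen U)
    (hne : U.Nonempty) :
    ∃ (x : ℕ → ℂ) (N : ℕ), ∑ i ∈ Finset.range N, lp.single 2 i (x i) ∈ U := by
  obtain ⟨x, hx⟩ := hne
  have h := (lp.hasSum_single (p := 2) (by norm_num) x).tendsto_sum_nat
  obtain ⟨N, hN⟩ := (h.eventually (hU.mem_nhds hx)).exists
  exact ⟨x, N, hN⟩

/-- Rolewicz's theorem. -/
theorem isHypercyclic_smul_backwardShift [TopologicalSpace.SeparableSpace (lp (fun _ : ℕ => ℂ) 2)]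
    (hB : ∀ (x : lp (fun _ : ℕ => ℂ) 2) (n : ℕ), B x n = x (n + 1)) {l : ℂ} (hl : 1 < ‖l‖) :
    IsHypercyclic (l • B) := by
  have hl0 : l ≠ 0 := norm_pos_iff.1 (zero_lt_one.trans hl)
  refine .of_transitive fun U V hU hV hUne hVne => ?_
  obtain ⟨x, N, hx⟩ := exists_sum_single_mem hU hUne
  obtain ⟨y, M, hy⟩ := exists_sum_single_mem hV hVne
  set xN : lp (fun _ : ℕ => ℂ) 2 := ∑ i ∈ Finset.range N, lp.single 2 i (x i)
  let w (n : ℕ) : lp (fun _ : ℕ => ℂ) 2 :=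
    (l⁻¹) ^ n • ∑ i ∈ Finset.range M, lp.single 2 (i + n) (y i)
  have hw : Tendsto w atTop (𝓝 0) := by
    have hpow : Tendsto (fun n : ℕ => ‖l⁻¹‖ ^ n * ∑ i ∈ Finset.range M, ‖y i‖) atTop (𝓝 0) := by
      simpa using (tendsto_pow_atTop_nhds_zero_of_lt_one (norm_nonneg l⁻¹)
        (by rw [norm_inv]; exact inv_lt_one_of_one_lt₀ hl)).mul_const
          (∑ i ∈ Finset.range M, ‖y i‖)
    refine squeeze_zero_norm (fun n => ?_) hpow
    rw [norm_smul, norm_pow]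
    gcongr
    refine norm_sum_le_of_le _ fun i _ => ?_
    rw [lp.norm_single (by norm_num)]
  have hU' : ∀ᶠ n in atTop, xN + w n ∈ U := by
    have : Tendsto (fun n => xN + w n) atTop (𝓝 xN) := by simpa using hw.const_add xN
    exact this.eventually (hU.mem_nhds hx)
  obtain ⟨n, hn, hNn⟩ := (hU'.and (eventually_ge_atTop N)).exists
  refine ⟨n, _, hn, ?_⟩
  have hxN : (B ^ n) xN = 0 := by
    rw [map_sum]
    exact Finset.sum_eq_zero fun i hi =>
      backwardShift_pow_single_of_lt hB ((Finset.mem_range.1 hi).trans_le hNn) _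
  have hwn : l ^ n • (B ^ n) (w n) = ∑ i ∈ Finset.range M, lp.single 2 i (y i) := by
    simp only [w, map_smul, map_sum, backwardShift_pow_single_add hB]
    rw [smul_smul, ← mul_pow, mul_inv_cancel₀ hl0, one_pow, one_smul]
  rw [smul_pow, smul_apply, map_add, hxN, zero_add, hwn]
  exact hy

end BackwardShift

/-- A multiple of the unilateral backward shift on `ℓ²(ℕ)` is hypercyclic if and only if
it is diskcyclic. -/
theorem backwardShift_smul_hypercyclic_iff_diskcyclic
    (B : lp (fun _ : ℕ => ℂ) 2 →L[ℂ] lp (fun _ : ℕ => ℂ) 2)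
    (hB : ∀ (x : lp (fun _ : ℕ => ℂ) 2) (n : ℕ), B x n = x (n + 1)) (l : ℂ) :
    IsHypercyclic (l • B) ↔ IsDiskcyclic (l • B) := by
  refine ⟨IsHypercyclic.isDiskcyclic, fun h => ?_⟩
  have := h.separableSpace
  have : Nontrivial (lp (fun _ : ℕ => ℂ) 2) :=
    ⟨lp.single 2 0 1, 0, fun h0 => by simpa using congrArg (fun x => x 0) h0⟩
  refine isHypercyclic_smul_backwardShift hB (h.one_lt_norm.trans_le ?_)
  rw [norm_smul]
  exact mul_le_of_le_one_right (norm_nonneg l) (norm_backwardShift_le hB)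
end

section
/- Let T be a diskcyclic bounded linear operator on a complex Hilbert space H and let λ ∈ ℂ with |λ| ≤ 1. Then the operator T − λI has dense range in H. -/
open Filter Topology

/-- A continuous linear functional `f` with `f ∘ T = l • f` and `|l| ≤ 1` vanishes
when `T` is diskcyclic. -/
theorem IsDiskcyclic.eq_zero_of_comp_eq_smul {H : Type*} [NormedAddCommGroup H]
    [NormedSpace ℂ H] {T : H →L[ℂ] H} (hT : IsDiskcyclic T) {l : ℂ} (hl : ‖l‖ ≤ 1)
    {f : H →L[ℂ] ℂ} (hf : ∀ y, f (T y) = l * f y) : f = 0 := by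
  obtain ⟨x, hx⟩ := hT
  have hpow : ∀ n : ℕ, f ((T ^ n) x) = l ^ n * f x := by
    intro n
    induction n with
    | zero => simp
    | succ n ih =>
      rw [pow_succ', mul_apply_eq_comp, hf, ih]
      ring
  have hbound : ∀ y, ‖f y‖ ≤ ‖f x‖ := by
    have hclosed : IsClosed {y : H | ‖f y‖ ≤ ‖f x‖} :=
      isClosed_le f.continuous.norm continuous_const
    intro y
    refine closure_minimal ?_ hclosed (hx y)
    rintro _ ⟨n, α, hα, rfl⟩
    simp only [Set.mem_ofPred_eq, map_smul, hpow, smul_eq_mul, norm_mul, norm_pow]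
    have hn : ‖l‖ ^ n ≤ 1 := pow_le_one₀ (norm_nonneg l) hl
    rw [← mul_assoc]
    exact mul_le_of_le_one_left (norm_nonneg _) (mul_le_one₀ hα (by positivity) hn)
  have hfx : ‖f x‖ ≤ 0 := by
    have h := hbound ((2 : ℂ) • x)
    rw [map_smul, norm_smul, Complex.norm_ofNat] at h
    linarith
  ext y
  exact norm_le_zero_iff.mp ((hbound y).trans hfx)

/-- If `T` is diskcyclic and `|λ| ≤ 1`, then `T - λI` has dense range. -/
theorem denseRange_sub_smul_id_of_diskcyclic {H : Type*} [NormedAddCommGroup H]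
    [InnerProductSpace ℂ H] [CompleteSpace H]
    (T : H →L[ℂ] H) (hT : IsDiskcyclic T) (l : ℂ) (hl : ‖l‖ ≤ 1) :
    DenseRange (T - l • (1 : H →L[ℂ] H)) := by
  have horth : (LinearMap.range (T - l • (1 : H →L[ℂ] H)).toLinearMap)ᗮ = ⊥ := by
    refine (Submodule.eq_bot_iff _).mpr fun v hv => ?_
    have hf : ∀ y, innerSL ℂ v (T y) = l * innerSL ℂ v y := by
      intro y
      have h := (Submodule.mem_orthogonal' _ v).mp hv _ (LinearMap.mem_range_self _ y)
      simpa [inner_sub_right, inner_smul_right, sub_eq_zero] using h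
    have hzero := hT.eq_zero_of_comp_eq_smul hl hf
    simpa using congrArg (fun g : H →L[ℂ] ℂ => g v) hzero
  have hdense := Submodule.dense_iff_topologicalClosure_eq_top.mpr
    ((Submodule.topologicalClosure_eq_top_iff).mpr horth)
  exact hdense
end

section
/- Let T be a bounded linear operator on a separable complex Hilbert space H and let α be a real number with α > 1. Then the operator S = T ⊕ αI_ℂ on the Hilbert space direct sum H ⊕ ℂ (acting by S(z ⊕ c) = Tz ⊕ αc) is diskcyclic if and only if the operator (1/α)T is hypercyclic on H. -/
open Filter Topology

theorem prodMap_pow_apply {H : Type*} [NormedAddCommGroup H] [NormedSpace ℂ H]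
    (T : H →L[ℂ] H) (a : ℂ) (n : ℕ) (x : H) (c : ℂ) :
    ((T.prodMap (a • (1 : ℂ →L[ℂ] ℂ))) ^ n) (x, c) = ((T ^ n) x, a ^ n * c) := by
  induction n with
  | zero => simp
  | succ n ih =>
    simp only [pow_succ', mul_apply_eq_comp, ih]
    simp [mul_assoc]

/-- If `x` is a hypercyclic vector, then every tail of its orbit is dense. -/
theorem IsHypercyclicVector.dense_tail {H : Type*} [NormedAddCommGroup H] [NormedSpace ℂ H]
    {T : H →L[ℂ] H} {x : H} (hx : IsHypercyclicVector T x) (N : ℕ) :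
    Dense {y : H | ∃ n : ℕ, N ≤ n ∧ y = (T ^ n) x} := by
  cases subsingleton_or_nontrivial H with
  | inl h => exact fun z => subset_closure ⟨N, le_rfl, Subsingleton.elim _ _⟩
  | inr h =>
    have : ∀ y : H, (𝓝[≠] y).NeBot := fun y => Module.punctured_nhds_neBot ℂ H y
    have hfin : ((fun n : ℕ => (T ^ n) x) '' Set.Iio N).Finite := (Set.finite_Iio N).image _
    refine (Dense.sdiff_finite hx hfin).mono ?_
    rintro y ⟨⟨n, rfl⟩, hn⟩
    exact ⟨n, not_lt.mp fun h => hn ⟨n, h, rfl⟩, rfl⟩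

theorem IsDiskcyclicVector.isHypercyclicVector_of_prodMap {H : Type*} [NormedAddCommGroup H]
    [NormedSpace ℂ H] {T : H →L[ℂ] H} {a : ℂ} {x : H} {c : ℂ}
    (h : IsDiskcyclicVector (T.prodMap (a • (1 : ℂ →L[ℂ] ℂ))) (x, c)) :
    IsHypercyclicVector (a⁻¹ • T) (c⁻¹ • x) := by
  intro z
  have hcont : ContinuousAt (fun p : H × ℂ => p.2⁻¹ • p.1) (z, 1) :=
    (continuousAt_snd.inv₀ one_ne_zero).smul continuousAt_fst
  have hev : ∀ᶠ p : H × ℂ in 𝓝 (z, 1), p.2 ≠ 0 :=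
    continuousAt_snd.eventually_ne one_ne_zero
  have hfreq := (mem_closure_iff_frequently.mp (h (z, 1))).and_eventually hev
  have htend : Tendsto (fun p : H × ℂ => p.2⁻¹ • p.1) (𝓝 (z, 1)) (𝓝 z) := by
    simpa [ContinuousAt] using hcont
  refine mem_closure_iff_frequently.mpr (htend.frequently (hfreq.mono ?_))
  rintro _ ⟨⟨n, γ, -, rfl⟩, hne⟩
  refine ⟨n, ?_⟩
  rw [prodMap_pow_apply] at hne ⊢
  have hγ : γ ≠ 0 := left_ne_zero_of_mul hne
  simp only [Prod.smul_mk, smul_eq_mul, smul_pow, smul_apply, map_smul,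
    smul_smul]
  congr 1
  rw [mul_inv, mul_inv, inv_pow]
  field_simp

theorem IsHypercyclicVector.isDiskcyclicVector_prodMap {H : Type*} [NormedAddCommGroup H]
    [NormedSpace ℂ H] {T : H →L[ℂ] H} {a : ℂ} (ha : 1 < ‖a‖) {x : H}
    (hx : IsHypercyclicVector (a⁻¹ • T) x) :
    IsDiskcyclicVector (T.prodMap (a • (1 : ℂ →L[ℂ] ℂ))) (x, 1) := by
  have ha₀ : a ≠ 0 := norm_pos_iff.mp (zero_lt_one.trans ha)
  have hdense : Dense {p : H × ℂ | p.2 ≠ 0} :=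
    (dense_compl_singleton (0 : ℂ)).preimage isOpenMap_snd
  refine dense_closure.mp (hdense.mono ?_)
  rintro ⟨z, w⟩ (hw : w ≠ 0)
  obtain ⟨N, hN⟩ := pow_unbounded_of_one_lt ‖w‖ ha
  have hcont : Continuous fun y : H => (w • y, w) := by fun_prop
  have hmem := map_mem_closure (t := {y : H × ℂ | ∃ (n : ℕ) (γ : ℂ), ‖γ‖ ≤ 1 ∧
    y = γ • ((T.prodMap (a • (1 : ℂ →L[ℂ] ℂ))) ^ n) (x, 1)}) hcont (hx.dense_tail N (w⁻¹ • z)) ?_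
  · simpa [smul_smul, hw] using hmem
  · rintro _ ⟨n, hn, rfl⟩
    refine ⟨n, w * (a ^ n)⁻¹, ?_, ?_⟩
    · have hle : ‖w‖ ≤ ‖a‖ ^ n := hN.le.trans (pow_le_pow_right₀ ha.le hn)
      rw [norm_mul, norm_inv, norm_pow, ← div_eq_mul_inv]
      exact div_le_one_of_le₀ hle (by positivity)
    · rw [prodMap_pow_apply]
      simp [smul_pow, smul_smul, ha₀]

/-- For `α > 1`, the operator `T ⊕ αI_ℂ` on `H ⊕ ℂ` is diskcyclic iff `(1/α)T` is
hypercyclic on `H`. -/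
theorem diskcyclic_prodMap_iff_hypercyclic {H : Type*} [NormedAddCommGroup H]
    [InnerProductSpace ℂ H] [CompleteSpace H] [TopologicalSpace.SeparableSpace H]
    (T : H →L[ℂ] H) (α : ℝ) (hα : 1 < α) :
    IsDiskcyclic (T.prodMap ((α : ℂ) • (1 : ℂ →L[ℂ] ℂ))) ↔
      IsHypercyclic (((α : ℂ))⁻¹ • T) := by
  constructor
  · rintro ⟨⟨x, c⟩, h⟩
    exact ⟨c⁻¹ • x, h.isHypercyclicVector_of_prodMap⟩
  · rintro ⟨x, hx⟩
    exact ⟨(x, 1), hx.isDiskcyclicVector_prodMap (by simpa using hα.trans_le (le_abs_self α))⟩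
end

section
/- Let T be a bounded linear operator on a separable complex Hilbert space H. Then T satisfies the Diskcyclic Criterion if and only if T satisfies the Diskcyclic Criterion with respect to some sequence (λ_{n_k}). -/
open Filter Topology

/-- `T` satisfies the Diskcyclic Criterion. -/
def SatisfiesDiskcyclicCriterion {H : Type*} [NormedAddCommGroup H] [NormedSpace ℂ H]
    (T : H →L[ℂ] H) : Prop :=
  ∃ (n : ℕ → ℕ), StrictMono n ∧ (∀ k, 0 < n k) ∧
    ∃ (X Y : Set H), Dense X ∧ Dense Y ∧
      ∃ S : ℕ → H → H,
        (∀ x ∈ X, ∀ y ∈ Y, Tendsto (fun k => ‖(T ^ (n k)) x‖ * ‖S k y‖) atTop (𝓝 0)) ∧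
        (∀ y ∈ Y, Tendsto (fun k => ‖S k y‖) atTop (𝓝 0)) ∧
        (∀ y ∈ Y, Tendsto (fun k => (T ^ (n k)) (S k y)) atTop (𝓝 y))

/-- `T` satisfies the Diskcyclic Criterion with respect to some sequence `(λ_{n_k})`. -/
def SatisfiesDiskcyclicCriterionWrtSequence {H : Type*} [NormedAddCommGroup H]
    [NormedSpace ℂ H] (T : H →L[ℂ] H) : Prop :=
  ∃ (n : ℕ → ℕ), StrictMono n ∧ (∀ k, 0 < n k) ∧
    ∃ l : ℕ → ℂ, (∀ k, l k ≠ 0) ∧ (∀ k, ‖l k‖ ≤ 1) ∧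
      ∃ (X Y : Set H), Dense X ∧ Dense Y ∧
        ∃ S : ℕ → H → H,
          (∀ x ∈ X, Tendsto (fun k => ‖l k • (T ^ (n k)) x‖) atTop (𝓝 0)) ∧
          (∀ y ∈ Y, Tendsto (fun k => ‖(l k)⁻¹ • S k y‖) atTop (𝓝 0)) ∧
          (∀ y ∈ Y, Tendsto (fun k => (T ^ (n k)) (S k y)) atTop (𝓝 y))

/-- In a separable normed space every dense set contains the range of a dense sequence. -/
theorem Dense.exists_denseRange_seq {H : Type*} [NormedAddCommGroup H]
    [TopologicalSpace.SeparableSpace H] {X : Set H} (hX : Dense X) :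
    ∃ x : ℕ → H, (∀ i, x i ∈ X) ∧ DenseRange x := by
  have := UniformSpace.secondCountable_of_separable H
  obtain ⟨t, htX, htc, htd⟩ := hX.exists_countable_dense_subset
  obtain ⟨x, rfl⟩ := htc.exists_eq_range htd.nonempty
  exact ⟨x, fun i => htX ⟨i, rfl⟩, htd⟩

/-- If `a * b ≤ ε ^ 2` and `b ≤ ε`, some `r ∈ (0, 1]` balances `a` and `b`. -/
theorem exists_scale_le {a b ε : ℝ} (hb : 0 ≤ b) (hε : 0 < ε)
    (hab : a * b ≤ ε ^ 2) (hbε : b ≤ ε) :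
    ∃ r : ℝ, 0 < r ∧ r ≤ 1 ∧ r * a ≤ ε ∧ r⁻¹ * b ≤ ε := by
  have hM : 0 < max a ε := lt_max_of_lt_right hε
  refine ⟨ε / max a ε, by positivity, (div_le_one hM).2 (le_max_right _ _), ?_, ?_⟩
  · rw [div_mul_eq_mul_div, div_le_iff₀ hM]
    exact mul_le_mul_of_nonneg_left (le_max_left _ _) hε.le
  · rw [inv_div, div_mul_eq_mul_div, div_le_iff₀ hε, max_mul_of_nonneg _ _ hb]
    exact max_le (by nlinarith) (by nlinarith)

/-- A diagonal argument: if `u i k * v j k → 0` and `v j k → 0` for all `i, j`, then along a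
subsequence there are scalars `r m ∈ (0, 1]` with `r m * u i → 0` and `(r m)⁻¹ * v j → 0`. -/
theorem exists_subseq_scale_tendsto_zero {u v : ℕ → ℕ → ℝ} (hu : ∀ i k, 0 ≤ u i k)
    (hv : ∀ j k, 0 ≤ v j k) (huv : ∀ i j, Tendsto (fun k => u i k * v j k) atTop (𝓝 0))
    (hv0 : ∀ j, Tendsto (v j) atTop (𝓝 0)) :
    ∃ (φ : ℕ → ℕ) (r : ℕ → ℝ), StrictMono φ ∧ (∀ m, 0 < r m) ∧ (∀ m, r m ≤ 1) ∧
      (∀ i, Tendsto (fun m => r m * u i (φ m)) atTop (𝓝 0)) ∧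
      (∀ j, Tendsto (fun m => (r m)⁻¹ * v j (φ m)) atTop (𝓝 0)) := by
  have hε (m : ℕ) : (0 : ℝ) < 1 / ((m : ℝ) + 1) := by positivity
  have hev (m : ℕ) : ∀ᶠ k in atTop,
      (∑ i ∈ Finset.range (m + 1), u i k) * (∑ j ∈ Finset.range (m + 1), v j k)
          ≤ (1 / ((m : ℝ) + 1)) ^ 2 ∧
        ∑ j ∈ Finset.range (m + 1), v j k ≤ 1 / ((m : ℝ) + 1) := by
    have h1 : Tendsto (fun k => (∑ i ∈ Finset.range (m + 1), u i k) *
        (∑ j ∈ Finset.range (m + 1), v j k)) atTop (𝓝 0) := by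
      simp_rw [Finset.sum_mul_sum]
      simpa using tendsto_finsetSum (Finset.range (m + 1)) fun i _ =>
        tendsto_finsetSum (Finset.range (m + 1)) fun j _ => huv i j
    have h2 : Tendsto (fun k => ∑ j ∈ Finset.range (m + 1), v j k) atTop (𝓝 0) := by
      simpa using tendsto_finsetSum (Finset.range (m + 1)) fun j _ => hv0 j
    exact (h1.eventually_le_const (pow_pos (hε m) 2)).and (h2.eventually_le_const (hε m))
  obtain ⟨φ, hφ, hP⟩ := extraction_forall_of_eventually hev
  choose r hr0 hr1 hra hrb using fun m =>
    exists_scale_le (Finset.sum_nonneg fun j _ => hv j (φ m)) (hε m) (hP m).1 (hP m).2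
  refine ⟨φ, r, hφ, hr0, hr1, fun i => ?_, fun j => ?_⟩
  · refine squeeze_zero' (.of_forall fun m => mul_nonneg (hr0 m).le (hu _ _)) ?_
      tendsto_one_div_add_atTop_nhds_zero_nat
    filter_upwards [eventually_ge_atTop i] with m hm
    refine le_trans (mul_le_mul_of_nonneg_left ?_ (hr0 m).le) (hra m)
    exact Finset.single_le_sum (f := fun i => u i (φ m)) (fun i _ => hu i _)
      (Finset.mem_range.2 (Nat.lt_succ_of_le hm))
  · refine squeeze_zero' (.of_forall fun m => mul_nonneg (inv_pos.2 (hr0 m)).le (hv _ _)) ?_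
      tendsto_one_div_add_atTop_nhds_zero_nat
    filter_upwards [eventually_ge_atTop j] with m hm
    refine le_trans (mul_le_mul_of_nonneg_left ?_ (inv_pos.2 (hr0 m)).le) (hrb m)
    exact Finset.single_le_sum (f := fun j => v j (φ m)) (fun j _ => hv j _)
      (Finset.mem_range.2 (Nat.lt_succ_of_le hm))

/-- Both diskcyclic criteria are equivalent. -/
theorem diskcyclicCriterion_iff_wrtSequence {H : Type*} [NormedAddCommGroup H]
    [InnerProductSpace ℂ H] [CompleteSpace H] [TopologicalSpace.SeparableSpace H]
    (T : H →L[ℂ] H) :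
    SatisfiesDiskcyclicCriterion T ↔ SatisfiesDiskcyclicCriterionWrtSequence T := by
  constructor
  · rintro ⟨n, hn, hn0, X, Y, hX, hY, S, hTS, hS, hTSy⟩
    obtain ⟨x, hxX, hx⟩ := hX.exists_denseRange_seq
    obtain ⟨y, hyY, hy⟩ := hY.exists_denseRange_seq
    obtain ⟨φ, r, hφ, hr0, hr1, hru, hrv⟩ :=
      exists_subseq_scale_tendsto_zero (u := fun i k => ‖(T ^ (n k)) (x i)‖)
        (v := fun j k => ‖S k (y j)‖) (fun _ _ => norm_nonneg _) (fun _ _ => norm_nonneg _)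
        (fun i j => hTS _ (hxX i) _ (hyY j)) (fun j => hS _ (hyY j))
    have hr (m : ℕ) : ‖(r m : ℂ)‖ = r m := Complex.norm_of_nonneg (hr0 m).le
    refine ⟨n ∘ φ, hn.comp hφ, fun k => hn0 _, fun m => (r m : ℂ),
      fun m => Complex.ofReal_ne_zero.2 (hr0 m).ne', fun m => (hr m).trans_le (hr1 m),
      Set.range x, Set.range y, hx, hy, fun m => S (φ m), ?_, ?_, ?_⟩
    · rintro _ ⟨i, rfl⟩
      simpa only [norm_smul, hr, Function.comp_apply] using hru i
    · rintro _ ⟨j, rfl⟩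
      simpa only [norm_smul, norm_inv, hr] using hrv j
    · rintro _ ⟨j, rfl⟩
      exact (hTSy _ (hyY j)).comp hφ.tendsto_atTop
  · rintro ⟨n, hn, hn0, l, hl0, hl1, X, Y, hX, hY, S, hT, hS, hTSy⟩
    refine ⟨n, hn, hn0, X, Y, hX, hY, S, fun x hx y hy => ?_, fun y hy => ?_, hTSy⟩
    · have h := (hT x hx).mul (hS y hy)
      rw [mul_zero] at h
      refine h.congr fun k => ?_
      have := norm_ne_zero_iff.2 (hl0 k)
      rw [norm_smul, norm_smul, norm_inv]
      field_simp
    · refine squeeze_zero (fun _ => norm_nonneg _) (fun k => ?_) (hS y hy)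
      rw [norm_smul, norm_inv]
      exact le_mul_of_one_le_left (norm_nonneg _)
        ((one_le_inv₀ (norm_pos_iff.2 (hl0 k))).2 (hl1 k))
end

section
/- Let T be a diskcyclic bounded linear operator on a complex Hilbert space H such that the adjoint T* has no eigenvalues (σ_p(T*) = ∅). Then there exists a dense linear subspace A of H that is invariant under T (T(A) ⊆ A) and such that every nonzero element of A is a diskcyclic vector for T. -/
open Filter Topology

/-- If no nonzero vector `v` satisfies `T* v = conj c • v`, then `T - c` has dense range. -/
theorem denseRange_sub_algebraMap {H : Type*} [NormedAddCommGroup H]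
    [InnerProductSpace ℂ H] [CompleteSpace H] (T : H →L[ℂ] H) (c : ℂ)
    (h : ∀ v : H, ContinuousLinearMap.adjoint T v = (starRingEnd ℂ c) • v → v = 0) :
    DenseRange (T - algebraMap ℂ (H →L[ℂ] H) c) := by
  have key : (LinearMap.range (T - algebraMap ℂ (H →L[ℂ] H) c).toLinearMap)ᗮ = ⊥ := by
    rw [Submodule.eq_bot_iff]
    intro v hv
    apply h
    rw [← sub_eq_zero]
    apply ext_inner_right ℂ
    intro w
    have hw := (Submodule.mem_orthogonal' _ v).1 hv _ (LinearMap.mem_range_self _ w)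
    simpa [inner_sub_left, inner_sub_right, ContinuousLinearMap.adjoint_inner_left,
      inner_smul_left, inner_smul_right, Algebra.algebraMap_eq_smul_one] using hw
  rw [← Submodule.topologicalClosure_eq_top_iff] at key
  exact Submodule.dense_iff_topologicalClosure_eq_top.2 key

/-- If `T*` has no eigenvalues, then `p(T)` has dense range for every polynomial `p ≠ 0`. -/
theorem denseRange_aeval {H : Type*} [NormedAddCommGroup H]
    [InnerProductSpace ℂ H] [CompleteSpace H] (T : H →L[ℂ] H)
    (hσ : ∀ (l : ℂ) (v : H), ContinuousLinearMap.adjoint T v = l • v → v = 0)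
    {p : Polynomial ℂ} (hp : p ≠ 0) : DenseRange (Polynomial.aeval T p) := by
  have hprod : ∀ s : Multiset ℂ,
      DenseRange (Polynomial.aeval T (s.map fun a => Polynomial.X - Polynomial.C a).prod) := by
    intro s
    induction s using Multiset.induction_on with
    | empty => simpa using Function.surjective_id.denseRange
    | cons a s ih =>
      have ha := denseRange_sub_algebraMap T a (hσ _)
      simpa [Function.comp_def, DenseRange] using ha.comp ih (ContinuousLinearMap.continuous _)
  have hlead : DenseRange fun v : H => p.leadingCoeff • v :=
    (MulAction.surjective₀ (Polynomial.leadingCoeff_ne_zero.2 hp)).denseRange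
  rw [(IsAlgClosed.splits p).eq_prod_roots]
  have := hlead.comp (hprod p.roots) (continuous_const_smul _)
  simpa [Function.comp_def, DenseRange, Algebra.algebraMap_eq_smul_one, Pi.smul_def] using this

/-- An operator with dense range that commutes with `T` preserves diskcyclic vectors of `T`. -/
theorem IsDiskcyclicVector.map_of_commute {H : Type*} [NormedAddCommGroup H] [NormedSpace ℂ H]
    {T S : H →L[ℂ] H} {x : H} (hx : IsDiskcyclicVector T x) (hS : DenseRange S)
    (hc : Commute S T) : IsDiskcyclicVector T (S x) := by
  refine (hS.dense_image S.continuous hx).mono ?_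
  rintro _ ⟨_, ⟨n, α, hα, rfl⟩, rfl⟩
  refine ⟨n, α, hα, ?_⟩
  have h : S ((T ^ n) x) = (T ^ n) (S x) := DFunLike.congr_fun (hc.pow_right n).eq x
  rw [map_smul, h]

/-- If `T` is diskcyclic and `T*` has no eigenvalues, then `T` has an invariant, dense
linear subspace all of whose nonzero elements are diskcyclic vectors for `T`. -/
theorem exists_dense_invariant_diskcyclic_subspace {H : Type*} [NormedAddCommGroup H]
    [InnerProductSpace ℂ H] [CompleteSpace H]
    (T : H →L[ℂ] H) (hT : IsDiskcyclic T)
    (hσ : ∀ (l : ℂ) (v : H), ContinuousLinearMap.adjoint T v = l • v → v = 0) :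
    ∃ A : Submodule ℂ H, Dense (A : Set H) ∧ (∀ a ∈ A, T a ∈ A) ∧
      ∀ a ∈ A, a ≠ 0 → IsDiskcyclicVector T a := by
  obtain ⟨x, hx⟩ := hT
  let A : Submodule ℂ H :=
    LinearMap.range ((ContinuousLinearMap.apply ℂ H x).toLinearMap ∘ₗ
      (Polynomial.aeval T : Polynomial ℂ →ₐ[ℂ] (H →L[ℂ] H)).toLinearMap)
  refine ⟨A, hx.mono ?_, ?_, ?_⟩
  · rintro _ ⟨n, α, -, rfl⟩
    exact ⟨α • Polynomial.X ^ n, by simp⟩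
  · rintro _ ⟨p, rfl⟩
    exact ⟨Polynomial.X * p, by simp⟩
  · rintro _ ⟨p, rfl⟩ hne
    have hp : p ≠ 0 := by
      rintro rfl
      exact hne (map_zero _)
    have hc : Commute (Polynomial.aeval T p) T := by
      simpa only [Polynomial.aeval_X] using
        (Commute.all p Polynomial.X).map (Polynomial.aeval T)
    exact hx.map_of_commute (denseRange_aeval T hσ hp) hc
end

section
/- Let T be a bounded linear operator on an infinite-dimensional separable complex Hilbert space H that satisfies the Diskcyclic Criterion with respect to a sequence (λ_{n_k}). Suppose that either (1) there is an infinite-dimensional closed linear subspace B of H such that ‖λ_{n_k} T^{n_k} z‖ → 0 for every z ∈ B, or (2) there is an infinite-dimensional closed linear subspace A of H such that for every z ∈ A the sequence (‖λ_{n_k} T^{n_k} z‖)_k is bounded. Then there exists an infinite-dimensional closed linear subspace M of H all of whose nonzero elements are diskcyclic vectors for T. -/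
open Filter Topology

open InnerProductSpace

section FiniteRank

variable {E H : Type*} [NormedAddCommGroup E] [InnerProductSpace ℂ E]
  [NormedAddCommGroup H] [InnerProductSpace ℂ H]

/-- The span of the rank-one operators `E → H`. -/
noncomputable def finiteRankOperators (E H : Type*) [NormedAddCommGroup E] [InnerProductSpace ℂ E]
    [NormedAddCommGroup H] [InnerProductSpace ℂ H] : Submodule ℂ (E →L[ℂ] H) :=
  Submodule.span ℂ (Set.range fun p : H × E => rankOne ℂ p.1 p.2)

lemma rankOne_mem_finiteRankOperators (x : H) (b : E) :
    rankOne ℂ x b ∈ finiteRankOperators E H :=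
  Submodule.subset_span ⟨(x, b), rfl⟩

lemma exists_finiteDimensional_vanish_orthogonal {K : E →L[ℂ] H}
    (hK : K ∈ finiteRankOperators E H) :
    ∃ G : Submodule ℂ E, FiniteDimensional ℂ G ∧ ∀ x ∈ Gᗮ, K x = 0 := by
  induction hK using Submodule.span_induction with
  | mem K h =>
    obtain ⟨⟨x, b⟩, rfl⟩ := h
    refine ⟨ℂ ∙ b, inferInstance, fun z hz => ?_⟩
    simp [Submodule.mem_orthogonal_singleton_iff_inner_right.1 hz]
  | zero => exact ⟨⊥, inferInstance, fun _ _ => rfl⟩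
  | add K L _ _ hK hL =>
    obtain ⟨G, hG, hG0⟩ := hK
    obtain ⟨G', hG', hG0'⟩ := hL
    refine ⟨G ⊔ G', inferInstance, fun x hx => ?_⟩
    simp [hG0 x (Submodule.orthogonal_le le_sup_left hx),
      hG0' x (Submodule.orthogonal_le le_sup_right hx)]
  | smul a K _ hK =>
    obtain ⟨G, hG, hG0⟩ := hK
    exact ⟨G, hG, fun x hx => by simp [hG0 x hx]⟩

lemma comp_starProjection_mem_finiteRankOperators (V : E →L[ℂ] H) (G : Submodule ℂ E)
    [FiniteDimensional ℂ G] : V ∘L G.starProjection ∈ finiteRankOperators E H := by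
  rw [(stdOrthonormalBasis ℂ G).starProjection_eq_sum_rankOne, ContinuousLinearMap.comp_finsetSum]
  refine Submodule.sum_mem _ fun i _ => ?_
  rw [comp_rankOne]
  exact rankOne_mem_finiteRankOperators _ _

/-- If `R k x → 0` for a dense set of `x`, then every finite-rank operator is a norm limit of
finite-rank operators `W` with `R k ∘ W → 0` in norm. -/
lemma exists_finiteRank_near_tendsto_zero {R : ℕ → H →L[ℂ] H}
    (hX : Dense {x | Tendsto (fun k => R k x) atTop (𝓝 0)})
    {V : E →L[ℂ] H} (hV : V ∈ finiteRankOperators E H) {ε : ℝ} (hε : 0 < ε) :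
    ∃ W ∈ finiteRankOperators E H, ‖W - V‖ < ε ∧
      Tendsto (fun k => R k ∘L W) atTop (𝓝 0) := by
  let N : Submodule ℂ (E →L[ℂ] H) :=
    { carrier := {W | W ∈ finiteRankOperators E H ∧ Tendsto (fun k => R k ∘L W) atTop (𝓝 0)}
      zero_mem' := ⟨zero_mem _, by simp⟩
      add_mem' := fun ha hb => ⟨add_mem ha.1 hb.1, by
        simpa [ContinuousLinearMap.comp_add] using ha.2.add hb.2⟩
      smul_mem' := fun c _ ha => ⟨Submodule.smul_mem _ c ha.1, by
        simpa [ContinuousLinearMap.comp_smul] using ha.2.const_smul c⟩ }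
  have hle : finiteRankOperators E H ≤ N.topologicalClosure := by
    refine Submodule.span_le.2 ?_
    rintro _ ⟨⟨x, b⟩, rfl⟩
    have hcont : Continuous fun x : H => rankOne ℂ x b :=
      ((rankOne ℂ : H →L[ℂ] E →L⋆[ℂ] E →L[ℂ] H).flip b).continuous
    refine map_mem_closure (f := fun x : H => rankOne ℂ x b) hcont (hX x)
      fun z hz => ⟨rankOne_mem_finiteRankOperators z b, ?_⟩
    simp only [comp_rankOne]
    simpa [Function.comp_def] using (hcont.tendsto 0).comp hz
  obtain ⟨W, hW, hWV⟩ := Metric.mem_closure_iff.1 (hle hV) ε hε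
  exact ⟨W, hW.1, by rwa [← dist_eq_norm, dist_comm], hW.2⟩

/-- The approximation step for the Baire category argument. -/
lemma exists_finiteRank_perturbation {R : ℕ → H →L[ℂ] H} {J : E →L[ℂ] H} {C : ℝ}
    (hC : ∀ k, ‖R k ∘L J‖ ≤ C)
    (hX : Dense {x | Tendsto (fun k => R k x) atTop (𝓝 0)})
    (hY : Dense {y | ∃ s : ℕ → H, Tendsto s atTop (𝓝 0) ∧
      Tendsto (fun k => R k (s k)) atTop (𝓝 y)})
    {u : E} (hu : u ≠ 0) (y : H) {δ ε : ℝ} (hδ : 0 < δ) (hε : 0 < ε)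
    {K : E →L[ℂ] H} (hK : K ∈ finiteRankOperators E H) :
    ∃ L ∈ finiteRankOperators E H, ‖L - K‖ < ε ∧
      ∃ k, ‖R k ((J + L) u) - y‖ < δ ∧ ‖R k ∘L (J + L)‖ < C + 1 + ‖y‖ / ‖u‖ := by
  have hu' : 0 < ‖u‖ := norm_pos_iff.2 hu
  obtain ⟨G₀, hG₀, hKG₀⟩ := exists_finiteDimensional_vanish_orthogonal hK
  set G : Submodule ℂ E := G₀ ⊔ ℂ ∙ u
  have huG : u ∈ G := (le_sup_right : ℂ ∙ u ≤ G) (Submodule.mem_span_singleton_self u)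
  have hKG : ∀ x ∈ Gᗮ, K x = 0 := fun x hx =>
    hKG₀ x (Submodule.orthogonal_le le_sup_left hx)
  set V : E →L[ℂ] H := (J + K) ∘L G.starProjection
  obtain ⟨W, hW, hWV, hW0⟩ := exists_finiteRank_near_tendsto_zero hX
    (comp_starProjection_mem_finiteRankOperators (J + K) G) (half_pos hε)
  obtain ⟨y', hy', s, hs0, hsy⟩ := Metric.dense_iff.1 hY y (min δ ‖u‖) (lt_min hδ hu')
  rw [Metric.mem_ball, dist_eq_norm, lt_min_iff] at hy'
  set v : E := ((‖u‖ : ℂ) ^ 2)⁻¹ • u with hv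
  have hvnorm : ‖v‖ = ‖u‖⁻¹ := by
    rw [hv, norm_smul, norm_inv, norm_pow, Complex.norm_real, norm_norm]
    field_simp
  have hvu : inner ℂ v u = 1 := by
    rw [hv, inner_smul_left, inner_self_eq_norm_sq_to_K]
    have : (‖u‖ : ℂ) ≠ 0 := by exact_mod_cast hu'.ne'
    simp [this]
  have hdecomp : ∀ k, J + (K + (W - V) + rankOne ℂ (s k) v) =
      J ∘L Gᗮ.starProjection + W + rankOne ℂ (s k) v := by
    intro k
    have h0 : K ∘L Gᗮ.starProjection = 0 := by
      ext x
      exact hKG _ (Submodule.starProjection_apply_mem _ _)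
    have h1 : J + K = J ∘L Gᗮ.starProjection + V := by
      have : (J + K) ∘L (Gᗮ.starProjection + G.starProjection) = J + K := by
        rw [Submodule.starProjection_orthogonal]
        ext x
        simp
      rw [ContinuousLinearMap.comp_add, ContinuousLinearMap.add_comp, h0, add_zero] at this
      exact this.symm
    rw [← add_assoc, ← add_assoc, h1]
    abel
  have hWu : Tendsto (fun k => R k (W u)) atTop (𝓝 0) := by
    simpa [Function.comp_def] using ((ContinuousLinearMap.apply ℂ H u).continuous.tendsto 0).comp hW0
  have hu0 : Gᗮ.starProjection u = 0 := by
    simp [Submodule.starProjection_orthogonal, Submodule.starProjection_eq_self_iff.2 huG]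
  have hlim₁ : Tendsto (fun k => ‖W - V‖ + ‖s k‖ * ‖v‖) atTop (𝓝 ‖W - V‖) := by
    simpa using (hs0.norm.mul_const ‖v‖).const_add ‖W - V‖
  have hlim₂ : Tendsto (fun k => ‖R k (W u) + R k (s k) - y‖) atTop (𝓝 ‖y' - y‖) := by
    simpa using ((hWu.add hsy).sub_const y).norm
  have hlim₃ : Tendsto (fun k => C + ‖R k ∘L W‖ + ‖R k (s k)‖ * ‖v‖) atTop
      (𝓝 (C + ‖y'‖ * ‖v‖)) := by
    simpa using (hW0.norm.const_add C).add (hsy.norm.mul_const ‖v‖)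
  have hlt₃ : C + ‖y'‖ * ‖v‖ < C + 1 + ‖y‖ / ‖u‖ := by
    have h : ‖y'‖ < ‖u‖ + ‖y‖ := by
      have := norm_sub_norm_le y' y
      linarith [hy'.2]
    have h' : ‖y'‖ / ‖u‖ < 1 + ‖y‖ / ‖u‖ := by
      rw [div_lt_iff₀ hu']
      field_simp
      exact h
    rw [hvnorm, ← div_eq_mul_inv]
    linarith
  obtain ⟨k, hk₁, hk₂, hk₃⟩ := ((hlim₁.eventually_lt_const (by linarith : ‖W - V‖ < ε)).and
    ((hlim₂.eventually_lt_const hy'.1).and (hlim₃.eventually_lt_const hlt₃))).exists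
  refine ⟨K + (W - V) + rankOne ℂ (s k) v, add_mem (add_mem hK (sub_mem hW
    (comp_starProjection_mem_finiteRankOperators _ _))) (rankOne_mem_finiteRankOperators _ _),
    ?_, k, ?_, ?_⟩
  · refine lt_of_le_of_lt ?_ hk₁
    rw [add_assoc, add_sub_cancel_left, ← norm_rankOne (𝕜 := ℂ)]
    exact norm_add_le _ _
  · rw [hdecomp]
    simpa [hu0, hvu] using hk₂
  · rw [hdecomp, ContinuousLinearMap.comp_add, ContinuousLinearMap.comp_add, comp_rankOne,
      ← ContinuousLinearMap.comp_assoc]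
    refine lt_of_le_of_lt ((norm_add₃_le).trans ?_) hk₃
    rw [norm_rankOne]
    gcongr
    refine (ContinuousLinearMap.opNorm_comp_le _ _).trans ?_
    exact (mul_le_of_le_one_right (norm_nonneg _) (Submodule.starProjection_norm_le _)).trans (hC k)

/-- A small perturbation of `J` sends every nonzero vector to a vector with dense orbit under the
sequence `R`. -/
lemma exists_perturbation_dense_orbits [TopologicalSpace.SeparableSpace E]
    [TopologicalSpace.SeparableSpace H] [CompleteSpace H]
    {R : ℕ → H →L[ℂ] H} {J : E →L[ℂ] H} {C : ℝ}
    (hC : ∀ k, ‖R k ∘L J‖ ≤ C)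
    (hX : Dense {x | Tendsto (fun k => R k x) atTop (𝓝 0)})
    (hY : Dense {y | ∃ s : ℕ → H, Tendsto s atTop (𝓝 0) ∧
      Tendsto (fun k => R k (s k)) atTop (𝓝 y)}) {ε : ℝ} (hε : 0 < ε) :
    ∃ K : E →L[ℂ] H, ‖K‖ < ε ∧
      ∀ x ≠ 0, Dense (Set.range fun k => R k ((J + K) x)) := by
  let 𝒦 : Submodule ℂ (E →L[ℂ] H) := (finiteRankOperators E H).topologicalClosure
  have : CompleteSpace 𝒦 := (Submodule.isClosed_topologicalClosure _).completeSpace_coe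
  let U : ℕ × ℕ × ℕ → Set 𝒦 := fun p => {K | TopologicalSpace.denseSeq E p.1 ≠ 0 →
    ∃ k, ‖R k ((J + K.1) (TopologicalSpace.denseSeq E p.1)) - TopologicalSpace.denseSeq H p.2.1‖
        < 1 / ((p.2.2 : ℝ) + 1) ∧
      ‖R k ∘L (J + K.1)‖ <
        C + 1 + ‖TopologicalSpace.denseSeq H p.2.1‖ / ‖TopologicalSpace.denseSeq E p.1‖}
  have hUo : ∀ p, IsOpen (U p) := by
    intro p
    by_cases hu : TopologicalSpace.denseSeq E p.1 = 0
    · simp [U, hu]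
    simp only [U, ne_eq, hu, not_false_eq_true, forall_const, Set.ofPred_exists]
    exact isOpen_iUnion fun k => (isOpen_lt (by fun_prop) (by fun_prop)).and
      (isOpen_lt (by fun_prop) (by fun_prop))
  have hUd : ∀ p, Dense (U p) := by
    intro p
    by_cases hu : TopologicalSpace.denseSeq E p.1 = 0
    · simp [U, hu]
    rw [Metric.dense_iff]
    intro K r hr
    obtain ⟨K₀, hK₀, hKK₀⟩ := Metric.mem_closure_iff.1 K.2 (r / 2) (half_pos hr)
    obtain ⟨L, hL, hLK, hk⟩ := exists_finiteRank_perturbation hC hX hY hu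
      (TopologicalSpace.denseSeq H p.2.1) (Nat.one_div_pos_of_nat (n := p.2.2)) (half_pos hr) hK₀
    refine ⟨⟨L, subset_closure hL⟩, ?_, fun _ => hk⟩
    rw [Metric.mem_ball, Subtype.dist_eq]
    rw [← dist_eq_norm] at hLK
    rw [dist_comm] at hKK₀
    linarith [dist_triangle L K₀ K.1]
  obtain ⟨K, hKε, hK⟩ := Metric.dense_iff.1 (dense_iInter_of_isOpen hUo hUd) 0 ε hε
  refine ⟨K.1, by simpa using hKε, fun x hx => Metric.dense_iff.2 fun y r hr => ?_⟩
  have hx' : 0 < ‖x‖ := norm_pos_iff.2 hx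
  have hC0 : 0 ≤ C := (norm_nonneg _).trans (hC 0)
  set B : ℝ := C + 1 + (‖y‖ + 1) / (‖x‖ / 2) with hB
  have hB0 : 0 < B := by positivity
  obtain ⟨_, ⟨i, rfl⟩, hi⟩ := Metric.mem_closure_iff.1 (TopologicalSpace.denseRange_denseSeq E x)
    (min (‖x‖ / 2) (r / 3 / B)) (by positivity)
  obtain ⟨_, ⟨j, rfl⟩, hj⟩ := Metric.mem_closure_iff.1 (TopologicalSpace.denseRange_denseSeq H y)
    (min 1 (r / 3)) (by positivity)
  obtain ⟨m, hm⟩ := exists_nat_one_div_lt (by positivity : 0 < r / 3)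
  set e := TopologicalSpace.denseSeq E i
  set w := TopologicalSpace.denseSeq H j
  rw [dist_eq_norm, lt_min_iff] at hi hj
  have hxe : ‖x‖ / 2 ≤ ‖e‖ := by linarith [norm_sub_norm_le x e]
  have hwy : ‖w‖ ≤ ‖y‖ + 1 := by linarith [norm_sub_norm_le w y, norm_sub_rev w y]
  obtain ⟨k, hk₁, hk₂⟩ := Set.mem_iInter.1 hK (i, j, m) (norm_pos_iff.1 (by linarith))
  refine ⟨_, ?_, k, rfl⟩
  have hop : ‖R k ∘L (J + K.1)‖ ≤ B := hk₂.le.trans (by rw [hB]; gcongr)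
  have hxe' : ‖(R k ∘L (J + K.1)) (x - e)‖ < r / 3 :=
    calc _ ≤ B * ‖x - e‖ := ContinuousLinearMap.le_of_opNorm_le _ hop _
      _ < B * (r / 3 / B) := by gcongr; exact hi.2
      _ = r / 3 := by field_simp
  have hsplit : R k ((J + K.1) x) - y =
      (R k ∘L (J + K.1)) (x - e) + (R k ((J + K.1) e) - w) + (w - y) := by
    simp only [ContinuousLinearMap.comp_apply, map_sub]
    abel
  rw [Metric.mem_ball, dist_eq_norm, hsplit]
  refine lt_of_le_of_lt norm_add₃_le ?_
  rw [norm_sub_rev w y]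
  linarith [hj.2]

end FiniteRank

/-- If `T` satisfies the Diskcyclic Criterion with respect to a sequence `(λ_{n_k})` and
either condition `𝓑₁` holds or the scaled orbits are bounded on an infinite-dimensional
closed subspace, then `T` has an infinite-dimensional closed subspace all of whose nonzero
elements are diskcyclic vectors. -/
theorem exists_infinite_dim_closed_diskcyclic_subspace {H : Type*} [NormedAddCommGroup H]
    [InnerProductSpace ℂ H] [CompleteSpace H] [TopologicalSpace.SeparableSpace H]
    (h_inf : ¬ FiniteDimensional ℂ H)
    (T : H →L[ℂ] H) (n : ℕ → ℕ) (hmono : StrictMono n) (hpos : ∀ k, 0 < n k)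
    (l : ℕ → ℂ) (hl0 : ∀ k, l k ≠ 0) (hl1 : ∀ k, ‖l k‖ ≤ 1)
    (X Y : Set H) (hX : Dense X) (hY : Dense Y) (S : ℕ → H → H)
    (h1 : ∀ x ∈ X, Tendsto (fun k => ‖l k • (T ^ (n k)) x‖) atTop (𝓝 0))
    (h2 : ∀ y ∈ Y, Tendsto (fun k => ‖(l k)⁻¹ • S k y‖) atTop (𝓝 0))
    (h3 : ∀ y ∈ Y, Tendsto (fun k => (T ^ (n k)) (S k y)) atTop (𝓝 y))
    (hsub :
      (∃ B : Submodule ℂ H, IsClosed (B : Set H) ∧ ¬ FiniteDimensional ℂ B ∧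
        ∀ z ∈ B, Tendsto (fun k => ‖l k • (T ^ (n k)) z‖) atTop (𝓝 0)) ∨
      (∃ A : Submodule ℂ H, IsClosed (A : Set H) ∧ ¬ FiniteDimensional ℂ A ∧
        ∀ z ∈ A, ∃ C : ℝ, ∀ k, ‖l k • (T ^ (n k)) z‖ ≤ C)) :
    ∃ M : Submodule ℂ H, IsClosed (M : Set H) ∧ ¬ FiniteDimensional ℂ M ∧
      ∀ z ∈ M, z ≠ 0 → IsDiskcyclicVector T z := by
  obtain ⟨A, hAc, hA, hAb⟩ : ∃ A : Submodule ℂ H, IsClosed (A : Set H) ∧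
      ¬ FiniteDimensional ℂ A ∧ ∀ z ∈ A, ∃ C : ℝ, ∀ k, ‖l k • (T ^ (n k)) z‖ ≤ C := by
    refine hsub.elim (fun ⟨B, hBc, hB, hB0⟩ => ⟨B, hBc, hB, fun z hz => ?_⟩) id
    obtain ⟨C, hC⟩ := (hB0 z hz).bddAbove_range
    exact ⟨C, fun k => hC ⟨k, rfl⟩⟩
  have : CompleteSpace A := hAc.completeSpace_coe
  have : SecondCountableTopology H := UniformSpace.secondCountable_of_separable H
  let R : ℕ → H →L[ℂ] H := fun k => l k • T ^ n k
  obtain ⟨C, hC⟩ : ∃ C, ∀ k, ‖R k ∘L A.subtypeL‖ ≤ C :=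
    banach_steinhaus fun z => hAb z z.2
  obtain ⟨K, hK, hKd⟩ := exists_perturbation_dense_orbits hC
    (hX.mono fun x hx => tendsto_zero_iff_norm_tendsto_zero.2 (h1 x hx))
    (hY.mono fun y hy => ⟨fun k => (l k)⁻¹ • S k y,
      tendsto_zero_iff_norm_tendsto_zero.2 (h2 y hy), by simpa [R, hl0] using h3 y hy⟩)
    (by norm_num : (0 : ℝ) < 1 / 2)
  have hanti : AntilipschitzWith 2 (A.subtypeL + K) := by
    refine ContinuousLinearMap.antilipschitz_of_bound _ fun x => ?_
    have h₁ : ‖K x‖ ≤ 1 / 2 * ‖x‖ := K.le_of_opNorm_le hK.le x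
    have h₂ : ‖(x : H)‖ - ‖K x‖ ≤ ‖(x : H) + K x‖ := norm_sub_le_norm_add _ _
    simp only [add_apply, Submodule.subtypeL_apply, NNReal.coe_ofNat]
    rw [Submodule.coe_norm] at *
    linarith
  refine ⟨(A.subtypeL + K).range, ?_, fun hfin => hA ?_, ?_⟩
  · exact hanti.isClosed_range (A.subtypeL + K).uniformContinuous
  · exact FiniteDimensional.of_injective (A.subtypeL + K).toLinearMap.rangeRestrict
      fun a b hab => hanti.injective (congrArg Subtype.val hab)
  · rintro _ ⟨x, rfl⟩ hx
    refine (hKd x (by rintro rfl; simp at hx)).mono ?_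
    rintro _ ⟨k, rfl⟩
    exact ⟨n k, l k, hl1 k, rfl⟩
end

section
/- Let T be a bounded linear operator on an infinite-dimensional separable complex Hilbert space H that satisfies the Diskcyclic Criterion, and suppose there is a normalized basic sequence (u_m) in H (i.e., ‖u_m‖ = 1 for all m and there exists a constant C ≥ 1 such that ‖Σ_{i=0}^{n} a_i u_i‖ ≤ C‖Σ_{i=0}^{p} a_i u_i‖ for all n ≤ p and all scalars a_0, …, a_p ∈ ℂ) such that Tu_m → 0 as m → ∞. Then there exists an infinite-dimensional closed linear subspace M of H all of whose nonzero elements are diskcyclic vectors for T. -/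
open Filter Topology

open scoped InnerProductSpace

/-- A recursive choice principle: a sequence whose `k`-th term satisfies `P k` and is related by
`r k` to all earlier terms. -/
theorem exists_seq_of_forall_nat_finset_exists {α : Type*} (P : ℕ → α → Prop)
    (r : ℕ → α → α → Prop)
    (h : ∀ k (s : Finset α), (∀ x ∈ s, ∃ i, P i x) → ∃ y, P k y ∧ ∀ x ∈ s, r k x y) :
    ∃ f : ℕ → α, (∀ k, P k (f k)) ∧ ∀ i k, i < k → r k (f i) (f k) := by
  classical
  have : Nonempty α := ⟨(h 0 ∅ (by simp)).choose⟩
  choose! g hg using h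
  let F : ℕ → Finset α := fun n => Nat.rec ∅ (fun n s => insert (g n s) s) n
  have hF : ∀ n, F (n + 1) = insert (g n (F n)) (F n) := fun n => rfl
  have hP : ∀ n, ∀ x ∈ F n, ∃ i, P i x := by
    intro n
    induction n with
    | zero => intro x hx; simp [F] at hx
    | succ n ih =>
      intro x hx
      rw [hF, Finset.mem_insert] at hx
      rcases hx with rfl | hx
      · exact ⟨n, (hg n (F n) ih).1⟩
      · exact ih x hx
  have hmem : ∀ i k, i < k → g i (F i) ∈ F k := by
    intro i k hik
    induction k, hik using Nat.le_induction with
    | base => simp [hF]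
    | succ k _ ih => rw [hF]; exact Finset.mem_insert_of_mem ih
  exact ⟨fun k => g k (F k), fun k => (hg k _ (hP k)).1,
    fun i k hik => (hg k _ (hP k)).2 _ (hmem i k hik)⟩

section Criterion

variable {H : Type*} [NormedAddCommGroup H] [NormedSpace ℂ H]

/-- The approximation step supplied by the Diskcyclic Criterion. -/
theorem SatisfiesDiskcyclicCriterion.exists_dense_forall_exists {T : H →L[ℂ] H}
    (hT : SatisfiesDiskcyclicCriterion T) :
    ∃ X : Set H, Dense X ∧ ∀ F : Finset H, (∀ f ∈ F, f ∈ X) → ∀ y : H, ∀ ε > 0, ∀ U ∈ 𝓝 (0 : H),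
      ∃ n : ℕ, 0 < n ∧ ∃ l : ℝ, 1 ≤ l ∧ ∃ x ∈ X, x ∈ U ∧
        ‖(T ^ n) x - (l : ℂ) • y‖ ≤ ε * l ∧ ∀ f ∈ F, ‖(T ^ n) f‖ ≤ ε * l := by
  obtain ⟨n, -, hn, X, Y, hX, hY, S, h1, h2, h3⟩ := hT
  refine ⟨X, hX, fun F hF y ε hε U hU => ?_⟩
  obtain ⟨y', hy', hyy⟩ := hY.exists_dist_lt y (ε := ε / 3) (by positivity)
  rw [dist_eq_norm] at hyy
  let l : ℕ → ℝ := fun k => 1 + ∑ f ∈ F, ‖(T ^ n k) f‖ / ε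
  have hl1 : ∀ k, 1 ≤ l k := fun k => by
    have : 0 ≤ ∑ f ∈ F, ‖(T ^ n k) f‖ / ε := Finset.sum_nonneg fun f _ => by positivity
    simp only [l]; linarith
  have hlF : ∀ k, ∀ f ∈ F, ‖(T ^ n k) f‖ ≤ ε * l k := fun k f hf => by
    have h := Finset.single_le_sum (f := fun f => ‖(T ^ n k) f‖ / ε)
      (fun f _ => by positivity) hf
    have h' : ‖(T ^ n k) f‖ / ε ≤ l k := by simp only [l] at h ⊢; linarith
    rw [div_le_iff₀ hε] at h'
    linarith
  have hlS : Tendsto (fun k => ((l k : ℝ) : ℂ) • S k y') atTop (𝓝 0) := by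
    rw [tendsto_zero_iff_norm_tendsto_zero]
    have h4 : Tendsto (fun k => ‖S k y'‖ + ∑ f ∈ F, ‖(T ^ n k) f‖ * ‖S k y'‖ / ε) atTop
        (𝓝 (0 + ∑ f ∈ F, 0 / ε)) :=
      (h2 y' hy').add (tendsto_finsetSum _ fun f hf => (h1 f (hF f hf) y' hy').div_const ε)
    simp only [zero_div, Finset.sum_const_zero, add_zero] at h4
    refine h4.congr fun k => ?_
    rw [norm_smul, Complex.norm_real, Real.norm_of_nonneg (by linarith [hl1 k])]
    simp only [l, add_mul, one_mul, Finset.sum_mul]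
    congr 1
    exact Finset.sum_congr rfl fun f _ => by ring
  have hTS : ∀ᶠ k in atTop, ‖(T ^ n k) (S k y') - y'‖ < ε / 3 := by
    have := (tendsto_iff_norm_sub_tendsto_zero.1 (h3 y' hy')).eventually_lt_const
      (show (0 : ℝ) < ε / 3 by positivity)
    exact this
  obtain ⟨k, hkU, hkT⟩ := ((hlS.eventually (eventually_mem_nhds_iff.2 hU)).and hTS).exists
  have hlpos : 0 < l k := by linarith [hl1 k]
  have hnear : ∀ᶠ x in 𝓝 (((l k : ℝ) : ℂ) • S k y'),
      ‖(T ^ n k) x - (T ^ n k) (((l k : ℝ) : ℂ) • S k y')‖ < ε / 3 := by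
    have hc : Continuous fun x => ‖(T ^ n k) x - (T ^ n k) (((l k : ℝ) : ℂ) • S k y')‖ := by
      fun_prop
    refine hc.continuousAt.eventually_lt_const ?_
    simpa using hε
  obtain ⟨x, ⟨hxU, hxT⟩, hxX⟩ := mem_closure_iff_nhds.1 (hX (((l k : ℝ) : ℂ) • S k y')) _
    (inter_mem hkU hnear)
  refine ⟨n k, hn k, l k, hl1 k, x, hxX, hxU, ?_, hlF k⟩
  have e : (T ^ n k) x - ((l k : ℝ) : ℂ) • y
      = ((T ^ n k) x - (T ^ n k) (((l k : ℝ) : ℂ) • S k y'))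
        + (((l k : ℝ) : ℂ) • ((T ^ n k) (S k y') - y') - ((l k : ℝ) : ℂ) • (y - y')) := by
    rw [map_smul]; module
  have hnl : ‖((l k : ℝ) : ℂ)‖ = l k := by
    rw [Complex.norm_real, Real.norm_of_nonneg hlpos.le]
  rw [e]
  refine (norm_add_le _ _).trans ?_
  have h5 := norm_sub_le (((l k : ℝ) : ℂ) • ((T ^ n k) (S k y') - y')) (((l k : ℝ) : ℂ) • (y - y'))
  rw [norm_smul, norm_smul, hnl] at h5
  have hxT' : ‖(T ^ n k) x - (T ^ n k) (((l k : ℝ) : ℂ) • S k y')‖ < ε / 3 := hxT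
  nlinarith [hl1 k]

/-- Distinct terms of a normalized basic sequence are uniformly separated. -/
theorem one_le_mul_norm_sub_of_basic_seq {u : ℕ → H} (hu_norm : ∀ m, ‖u m‖ = 1) {C : ℝ}
    (hC : ∀ (m p : ℕ), m ≤ p → ∀ a : ℕ → ℂ,
      ‖∑ i ∈ Finset.range (m + 1), a i • u i‖ ≤ C * ‖∑ i ∈ Finset.range (p + 1), a i • u i‖)
    {m p : ℕ} (hmp : m < p) : 1 ≤ C * ‖u m - u p‖ := by
  have h := hC m p hmp.le (Pi.single m 1 - Pi.single p 1)
  have h1 : ∑ i ∈ Finset.range (m + 1), (Pi.single m (1 : ℂ) - Pi.single p 1 : ℕ → ℂ) i • u i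
      = u m := by
    simp [sub_smul, Finset.sum_sub_distrib, Pi.single_apply, ite_smul]
    omega
  have h2 : ∑ i ∈ Finset.range (p + 1), (Pi.single m (1 : ℂ) - Pi.single p 1 : ℕ → ℂ) i • u i
      = u m - u p := by
    simp [sub_smul, Finset.sum_sub_distrib, Pi.single_apply, ite_smul]
    omega
  rwa [h1, h2, hu_norm] at h

end Criterion

section Hilbert

variable {H : Type*} [NormedAddCommGroup H] [InnerProductSpace ℂ H]

/-- If `T` tends to zero along a bounded separated sequence, then every finite set has unit vectors
in its orthogonal complement with arbitrarily small image under `T`. -/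
theorem exists_unit_orthogonal_map_mem_nhds {T : H →L[ℂ] H} {u : ℕ → H}
    (hu_norm : ∀ m, ‖u m‖ = 1) {C : ℝ} (hC : 0 < C)
    (hsep : ∀ m p, m < p → 1 ≤ C * ‖u m - u p‖)
    (hTu : Tendsto (fun m => T (u m)) atTop (𝓝 0)) (s : Finset H) {U : Set H}
    (hU : U ∈ 𝓝 (0 : H)) :
    ∃ o : H, ‖o‖ = 1 ∧ (∀ w ∈ s, ⟪w, o⟫_ℂ = 0) ∧ T o ∈ U := by
  let W : Submodule ℂ H := Submodule.span ℂ (s : Set H)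
  have : FiniteDimensional ℂ W := FiniteDimensional.span_finset ℂ s
  have : ProperSpace W := FiniteDimensional.proper ℂ W
  obtain ⟨c, -, φ, hφ, hc⟩ := tendsto_subseq_of_bounded (x := fun m => W.orthogonalProjectionOnto (u m))
    (Metric.isBounded_closedBall (x := (0 : W)) (r := 1)) (fun m => by
      rw [mem_closedBall_zero_iff, ← hu_norm m]
      exact W.norm_orthogonalProjectionOnto_apply_le (u m))
  let w : ℕ → H := fun m => u (φ m) - u (φ (m + 1))
  have hPw : Tendsto (fun m => (W.orthogonalProjectionOnto (w m) : H)) atTop (𝓝 0) := by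
    have h := hc.sub (hc.comp (tendsto_add_atTop_nat 1))
    rw [sub_self] at h
    have h' := (continuous_subtype_val.tendsto (0 : W)).comp h
    refine h'.congr fun m => ?_
    simp [w]
  have hTw : Tendsto (fun m => T (w m)) atTop (𝓝 0) := by
    have h := (hTu.comp hφ.tendsto_atTop).sub
      ((hTu.comp hφ.tendsto_atTop).comp (tendsto_add_atTop_nat 1))
    rw [sub_self] at h
    refine h.congr fun m => ?_
    simp [w]
  let q : ℕ → H := fun m => w m - W.orthogonalProjectionOnto (w m)
  have hTq : Tendsto (fun m => T (q m)) atTop (𝓝 0) := by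
    have h := hTw.sub ((T.continuous.tendsto 0).comp hPw)
    rw [map_zero, sub_zero] at h
    refine h.congr fun m => ?_
    simp [q]
  have hq : ∀ᶠ m in atTop, 1 / (2 * C) ≤ ‖q m‖ := by
    have h := (tendsto_zero_iff_norm_tendsto_zero.1 hPw).eventually_lt_const
      (show (0 : ℝ) < 1 / (2 * C) by positivity)
    filter_upwards [h] with m hm
    have h1 : 1 / C ≤ ‖w m‖ := by
      rw [div_le_iff₀ hC, mul_comm]
      exact hsep _ _ (hφ (Nat.lt_succ_self m))
    have h2 : ‖w m‖ - ‖(W.orthogonalProjectionOnto (w m) : H)‖ ≤ ‖q m‖ := norm_sub_norm_le _ _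
    have h3 : 1 / C = 1 / (2 * C) + 1 / (2 * C) := by field_simp; norm_num
    linarith
  have hTo : Tendsto (fun m => T (((‖q m‖⁻¹ : ℝ) : ℂ) • q m)) atTop (𝓝 0) := by
    have h := (tendsto_zero_iff_norm_tendsto_zero.1 hTq).const_mul (2 * C)
    rw [mul_zero] at h
    refine squeeze_zero_norm' ?_ h
    filter_upwards [hq] with m hm
    rw [map_smul, norm_smul, Complex.norm_real, norm_inv, norm_norm]
    gcongr
    rw [inv_le_comm₀ (lt_of_lt_of_le (by positivity) hm) (by positivity)]
    simpa using hm
  obtain ⟨m, hmU, hm⟩ := ((hTo.eventually hU).and hq).exists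
  have hpos : 0 < ‖q m‖ := lt_of_lt_of_le (by positivity) hm
  refine ⟨((‖q m‖⁻¹ : ℝ) : ℂ) • q m, ?_, fun v hv => ?_, hmU⟩
  · rw [norm_smul, Complex.norm_real, norm_inv, norm_norm, inv_mul_cancel₀ hpos.ne']
  · have : ⟪v, q m⟫_ℂ = 0 :=
      W.sub_starProjection_mem_orthogonal (w m) v (Submodule.subset_span hv)
    rw [inner_smul_right, this, mul_zero]

/-- One stage of the construction of a diskcyclic subspace: a power `n`, a scaling factor `l`, a
small vector `x` sent by `T ^ n` close to `l` times a prescribed target, and a vector `v` close to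
a unit vector `o`. -/
structure DiskcyclicStage (H : Type*) where
  n : ℕ
  l : ℝ
  x : H
  v : H
  o : H

/-- The conditions on a single stage with target `y` and precision `ε`. -/
structure DiskcyclicStage.IsGood (T : H →L[ℂ] H) (X : Set H) (y : H) (ε : ℝ)
    (p : DiskcyclicStage H) : Prop where
  n_pos : 0 < p.n
  one_le_l : 1 ≤ p.l
  x_mem : p.x ∈ X
  v_mem : p.v ∈ X
  norm_o : ‖p.o‖ = 1
  norm_x : ‖p.x‖ ≤ ε
  norm_v_sub_o : ‖p.v - p.o‖ ≤ ε
  norm_map_v : ‖(T ^ p.n) p.v‖ ≤ ε ^ 2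
  norm_map_x_sub : ‖(T ^ p.n) p.x - (p.l : ℂ) • y‖ ≤ ε ^ 2 * p.l

/-- The conditions relating a stage `q` of precision `ε` to an earlier stage `p`. -/
structure DiskcyclicStage.IsCompatible (T : H →L[ℂ] H) (ε : ℝ) (p q : DiskcyclicStage H) :
    Prop where
  inner_eq_zero : ⟪p.o, q.o⟫_ℂ = 0
  norm_map_v_left : ‖(T ^ q.n) p.v‖ ≤ ε ^ 2 * q.l
  norm_map_x_left : ‖(T ^ q.n) p.x‖ ≤ ε ^ 2 * q.l
  norm_map_v_right : ‖(T ^ p.n) q.v‖ ≤ ε ^ 2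
  norm_map_x_right : ‖(T ^ p.n) q.x‖ ≤ ε ^ 2

theorem exists_diskcyclicStage {T : H →L[ℂ] H} {X : Set H} (hX : Dense X)
    (hXT : ∀ F : Finset H, (∀ f ∈ F, f ∈ X) → ∀ y : H, ∀ ε > 0, ∀ U ∈ 𝓝 (0 : H),
      ∃ n : ℕ, 0 < n ∧ ∃ l : ℝ, 1 ≤ l ∧ ∃ x ∈ X, x ∈ U ∧
        ‖(T ^ n) x - (l : ℂ) • y‖ ≤ ε * l ∧ ∀ f ∈ F, ‖(T ^ n) f‖ ≤ ε * l)
    (hO : ∀ (s : Finset H), ∀ U ∈ 𝓝 (0 : H),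
      ∃ o : H, ‖o‖ = 1 ∧ (∀ w ∈ s, ⟪w, o⟫_ℂ = 0) ∧ T o ∈ U)
    (y : H) {ε : ℝ} (hε : 0 < ε) (s : Finset (DiskcyclicStage H))
    (hs : ∀ p ∈ s, 0 < p.n ∧ p.x ∈ X ∧ p.v ∈ X) :
    ∃ q : DiskcyclicStage H, q.IsGood T X y ε ∧ ∀ p ∈ s, p.IsCompatible T ε q := by
  classical
  have hε2 : 0 < ε ^ 2 := by positivity
  have hsmall : ∀ n : ℕ, ∀ᶠ x in 𝓝 (0 : H), ‖(T ^ n) x‖ < ε ^ 2 := fun n => by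
    have hc : Continuous fun x => ‖(T ^ n) x‖ := by fun_prop
    refine hc.continuousAt.eventually_lt_const ?_
    simpa using hε2
  have hU : ∀ᶠ x in 𝓝 (0 : H), ‖x‖ < ε ∧ ∀ p ∈ s, ‖(T ^ p.n) x‖ < ε ^ 2 := by
    refine Eventually.and ?_ ((eventually_all_finset s).2 fun p _ => hsmall p.n)
    simpa using Metric.eventually_nhds_iff_ball.2 ⟨ε, hε, fun v (hv : v ∈ Metric.ball (0 : H) ε) =>
      mem_ball_zero_iff.1 hv⟩
  obtain ⟨n, hn, l, hl, x, hxX, ⟨hx, hxs⟩, hxy, hF⟩ :=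
    hXT (s.image (·.x) ∪ s.image (·.v)) (by
      intro f hf
      simp only [Finset.mem_union, Finset.mem_image] at hf
      rcases hf with ⟨p, hp, rfl⟩ | ⟨p, hp, rfl⟩
      exacts [(hs p hp).2.1, (hs p hp).2.2]) y (ε ^ 2) hε2 _ hU
  have hU' : ∀ᶠ z in 𝓝 (0 : H), ‖(T ^ (n - 1)) z‖ < ε ^ 2 ∧
      ∀ p ∈ s, ‖(T ^ (p.n - 1)) z‖ < ε ^ 2 :=
    (hsmall _).and ((eventually_all_finset s).2 fun p _ => hsmall _)
  obtain ⟨o, ho1, hos, ho, hops⟩ := hO (s.image (·.o)) _ hU'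
  have hpow : ∀ k : ℕ, 0 < k → (T ^ (k - 1)) (T o) = (T ^ k) o := fun k hk => by
    obtain ⟨k, rfl⟩ := Nat.exists_eq_succ_of_ne_zero hk.ne'
    simp [pow_succ]
  have hnear : ∀ k : ℕ, ‖(T ^ k) o‖ < ε ^ 2 → ∀ᶠ v in 𝓝 o, ‖(T ^ k) v‖ < ε ^ 2 := fun k hk => by
    have hc : Continuous fun x => ‖(T ^ k) x‖ := by fun_prop
    exact hc.continuousAt.eventually_lt_const hk
  have hV : ∀ᶠ v in 𝓝 o, ‖v - o‖ < ε ∧ ‖(T ^ n) v‖ < ε ^ 2 ∧ ∀ p ∈ s, ‖(T ^ p.n) v‖ < ε ^ 2 := by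
    refine Eventually.and ?_ ((hnear n (by rw [← hpow n hn]; exact ho)).and
      ((eventually_all_finset s).2 fun p hp => hnear _ ?_))
    · exact Metric.eventually_nhds_iff_ball.2 ⟨ε, hε, fun v hv => mem_ball_iff_norm.1 hv⟩
    · rw [← hpow _ (hs p hp).1]; exact hops p hp
  obtain ⟨v, ⟨hvo, hvn, hvs⟩, hvX⟩ := mem_closure_iff_nhds.1 (hX o) _ hV
  refine ⟨⟨n, l, x, v, o⟩, ⟨hn, hl, hxX, hvX, ho1, hx.le, hvo.le, hvn.le, hxy⟩, fun p hp =>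
    ⟨hos _ (Finset.mem_image_of_mem _ hp), hF _ ?_, hF _ ?_, (hvs p hp).le, (hxs p hp).le⟩⟩
  · exact Finset.mem_union_right _ (Finset.mem_image_of_mem _ hp)
  · exact Finset.mem_union_left _ (Finset.mem_image_of_mem _ hp)

/-- A norm-summable perturbation, of total size at most `1 / 2`, of the isometry of `ℓ²` induced by
an orthonormal sequence is a bounded below operator. -/
theorem Orthonormal.exists_perturbed_embedding [CompleteSpace H] {o : ℕ → H} (ho : Orthonormal ℂ o)
    {d x : ℕ → H} {j : ℕ → ℕ} {ε : ℕ → ℝ} (hd : ∀ i, ‖d i‖ ≤ ε i) (hx : ∀ i, ‖x i‖ ≤ ε i)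
    (hε : HasSum ε (1 / 4)) :
    ∃ K : lp (fun _ : ℕ => ℂ) 2 →L[ℂ] H, (∀ a, ‖a‖ ≤ 2 * ‖K a‖) ∧
      ∀ a, HasSum (fun i => a i • (o i + d i) + a (j i) • x i) (K a) := by
  let V := ho.orthogonalFamily.linearIsometry
  let D : ℕ → (lp (fun _ : ℕ => ℂ) 2 →L[ℂ] H) := fun i =>
    (lp.evalCLM ℂ (fun _ : ℕ => ℂ) 2 i).smulRight (d i) +
      (lp.evalCLM ℂ (fun _ : ℕ => ℂ) 2 (j i)).smulRight (x i)
  have hDa : ∀ i a, D i a = a i • d i + a (j i) • x i := fun i a => rfl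
  have hε0 : ∀ i, 0 ≤ ε i := fun i => (norm_nonneg _).trans (hd i)
  have hD : ∀ i, ‖D i‖ ≤ 2 * ε i := fun i => by
    refine ContinuousLinearMap.opNorm_le_bound _ (by linarith [hε0 i]) fun a => ?_
    rw [hDa]
    refine (norm_add_le _ _).trans ?_
    rw [norm_smul, norm_smul]
    have h1 := mul_le_mul (lp.norm_apply_le_norm two_ne_zero a i) (hd i) (norm_nonneg _)
      (norm_nonneg a)
    have h2 := mul_le_mul (lp.norm_apply_le_norm two_ne_zero a (j i)) (hx i) (norm_nonneg _)
      (norm_nonneg a)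
    linarith
  have hsum : Summable D := Summable.of_norm_bounded (hε.summable.mul_left 2) hD
  have hDn : ‖∑' i, D i‖ ≤ 2 * (1 / 4) := tsum_of_norm_bounded (hε.mul_left 2) hD
  refine ⟨V.toContinuousLinearMap + ∑' i, D i, fun a => ?_, fun a => ?_⟩
  · have h1 : ‖(∑' i, D i) a‖ ≤ 2 * (1 / 4) * ‖a‖ := ContinuousLinearMap.le_of_opNorm_le _ hDn a
    have h2 : ‖V a‖ = ‖a‖ := V.norm_map a
    have h3 : ‖V a‖ - ‖(∑' i, D i) a‖ ≤ ‖V a + (∑' i, D i) a‖ := norm_sub_le_norm_add _ _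
    rw [add_apply]
    change ‖a‖ ≤ 2 * ‖V a + _‖
    linarith
  · have h1 : HasSum (fun i => a i • o i) (V a) := by
      simpa using ho.orthogonalFamily.hasSum_linearIsometry a
    have h2 : HasSum (fun i => D i a) ((∑' i, D i) a) :=
      hsum.hasSum.mapL (ContinuousLinearMap.apply ℂ H a)
    refine (h1.add h2).congr_fun fun i => ?_
    rw [hDa]; module

theorem not_finiteDimensional_lp_two_nat : ¬ FiniteDimensional ℂ (lp (fun _ : ℕ => ℂ) 2) := by
  intro h
  have hs : LinearIndependent ℂ (fun i : ℕ => lp.single (E := fun _ : ℕ => ℂ) 2 i (1 : ℂ)) := by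
    refine LinearIndependent.of_comp
      (LinearMap.pi fun i => lp.evalₗ (𝕜 := ℂ) (fun _ : ℕ => ℂ) 2 i) ?_
    convert Pi.linearIndependent_single_one ℕ ℂ using 1
    · ext i k
      simp
    · rfl
  exact not_finite_iff_infinite.2 (inferInstanceAs (Infinite ℕ)) hs.finite

/-- The vectors `K a` with `a ≠ 0` are diskcyclic if `K` is given by a sequence of stages whose
pairing of coefficients and targets visits every pair infinitely often. -/
theorem isDiskcyclicVector_of_stages {T : H →L[ℂ] H} {X : Set H} {q : ℕ → H}
    (hq : DenseRange q) {j m : ℕ → ℕ} (hjm : ∀ a b, ∃ k : ℕ → ℕ, Tendsto k atTop atTop ∧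
      ∀ t, j (k t) = a ∧ m (k t) = b) {ε : ℕ → ℝ} (hanti : Antitone ε)
    (hε : HasSum ε (1 / 4)) {f : ℕ → DiskcyclicStage H}
    (hf : ∀ k, (f k).IsGood T X (q (m k)) (ε k))
    (hfc : ∀ i k, i < k → (f i).IsCompatible T (ε k) (f k))
    {a : lp (fun _ : ℕ => ℂ) 2} (ha : a ≠ 0) {z : H}
    (hz : HasSum (fun i => a i • (f i).v + a (j i) • (f i).x) z) : IsDiskcyclicVector T z := by
  have hε0 : ∀ k, 0 ≤ ε k := fun k => (norm_nonneg _).trans (hf k).norm_x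
  have hεε : ∀ {i k}, i ≤ k → ε k ^ 2 ≤ ε k * ε i := fun {i k} h => by
    rw [sq]; exact mul_le_mul_of_nonneg_left (hanti h) (hε0 k)
  have hl : ∀ k, 0 < (f k).l := fun k => by linarith [(hf k).one_le_l]
  have hll : ∀ {i k} {b : ℝ}, b ≤ ε k * ε i → b ≤ ε k * ε i * (f k).l := fun {i k b} h =>
    h.trans (le_mul_of_one_le_right (mul_nonneg (hε0 k) (hε0 i)) (hf k).one_le_l)
  have hv : ∀ k i, ‖(T ^ (f k).n) (f i).v‖ ≤ ε k * ε i * (f k).l := fun k i => by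
    rcases lt_trichotomy i k with h | rfl | h
    · exact (hfc i k h).norm_map_v_left.trans
        (mul_le_mul_of_nonneg_right (hεε h.le) (hl k).le)
    · exact hll ((hf i).norm_map_v.trans (hεε le_rfl))
    · exact hll ((hfc k i h).norm_map_v_right.trans ((hεε h.le).trans_eq (mul_comm _ _)))
  have hx : ∀ k i, ‖(T ^ (f k).n) (f i).x - (if i = k then ((f k).l : ℂ) • q (m k) else 0)‖
      ≤ ε k * ε i * (f k).l := fun k i => by
    rcases lt_trichotomy i k with h | rfl | h
    · rw [if_neg h.ne, sub_zero]
      exact (hfc i k h).norm_map_x_left.trans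
        (mul_le_mul_of_nonneg_right (hεε h.le) (hl k).le)
    · rw [if_pos rfl]
      exact (hf i).norm_map_x_sub.trans (mul_le_mul_of_nonneg_right (hεε le_rfl) (hl i).le)
    · rw [if_neg h.ne', sub_zero]
      exact hll ((hfc k i h).norm_map_x_right.trans ((hεε h.le).trans_eq (mul_comm _ _)))
  have key : ∀ k, ‖(((f k).l⁻¹ : ℝ) : ℂ) • (T ^ (f k).n) z - a (j k) • q (m k)‖
      ≤ ‖a‖ * ε k := fun k => by
    have h1 := (hz.mapL (T ^ (f k).n)).sub
      (hasSum_ite_eq k (a (j k) • ((f k).l : ℂ) • q (m k)))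
    have h2 := h1.norm_le_of_bounded (hε.mul_left (‖a‖ * (2 * ε k * (f k).l))) fun i => by
      have e : (T ^ (f k).n) (a i • (f i).v + a (j i) • (f i).x)
          - (if i = k then a (j k) • ((f k).l : ℂ) • q (m k) else 0)
          = a i • (T ^ (f k).n) (f i).v + a (j i) • ((T ^ (f k).n) (f i).x
            - (if i = k then ((f k).l : ℂ) • q (m k) else 0)) := by
        split_ifs with h
        · subst h; rw [map_add, map_smul, map_smul]; module
        · rw [map_add, map_smul, map_smul, sub_zero, sub_zero]
      rw [e]
      refine (norm_add_le _ _).trans ?_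
      rw [norm_smul, norm_smul]
      have h3 := mul_le_mul (lp.norm_apply_le_norm two_ne_zero a i) (hv k i) (norm_nonneg _)
        (norm_nonneg a)
      have h4 := mul_le_mul (lp.norm_apply_le_norm two_ne_zero a (j i)) (hx k i) (norm_nonneg _)
        (norm_nonneg a)
      linarith
    have e : (((f k).l⁻¹ : ℝ) : ℂ) • (T ^ (f k).n) z - a (j k) • q (m k)
        = (((f k).l⁻¹ : ℝ) : ℂ) • ((T ^ (f k).n) z - a (j k) • ((f k).l : ℂ) • q (m k)) := by
      have : (((f k).l⁻¹ : ℝ) : ℂ) * ((f k).l : ℂ) = 1 := by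
        rw [← Complex.ofReal_mul, inv_mul_cancel₀ (hl k).ne', Complex.ofReal_one]
      rw [smul_sub, smul_comm (a (j k)), smul_smul, this, one_smul]
    rw [e, norm_smul, Complex.norm_real, norm_inv, Real.norm_of_nonneg (hl k).le,
      inv_mul_le_iff₀ (hl k)]
    refine h2.trans ?_
    have := mul_nonneg (mul_nonneg (norm_nonneg a) (hε0 k)) (hl k).le
    linarith
  obtain ⟨i, hi⟩ : ∃ i, a i ≠ 0 := by
    by_contra! h
    exact ha (lp.ext (funext h))
  set S := {y : H | ∃ (n : ℕ) (α : ℂ), ‖α‖ ≤ 1 ∧ y = α • (T ^ n) z} with hS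
  have hcl : IsClosed {w : H | a i • w ∈ closure S} :=
    isClosed_closure.preimage (continuous_const_smul (a i))
  have hqS : Set.range q ⊆ {w : H | a i • w ∈ closure S} := by
    rintro _ ⟨b, rfl⟩
    obtain ⟨k, hk, hkt⟩ := hjm i b
    refine mem_closure_of_tendsto (f := fun t => (((f (k t)).l⁻¹ : ℝ) : ℂ) •
      (T ^ (f (k t)).n) z) (b := atTop) ?_ (Eventually.of_forall fun t => ?_)
    · rw [tendsto_iff_norm_sub_tendsto_zero]
      have h := ((hε.summable.tendsto_atTop_zero.comp hk).const_mul ‖a‖)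
      rw [mul_zero] at h
      refine squeeze_zero (fun _ => norm_nonneg _) (fun t => ?_) h
      have := key (k t)
      rwa [(hkt t).1, (hkt t).2] at this
    · refine ⟨_, _, ?_, rfl⟩
      rw [Complex.norm_real, norm_inv, Real.norm_of_nonneg (hl _).le]
      exact inv_le_one_of_one_le₀ (hf _).one_le_l
  intro y
  have h : (a i)⁻¹ • y ∈ {w : H | a i • w ∈ closure S} :=
    hcl.closure_subset_iff.2 hqS (hq _)
  rwa [Set.mem_ofPred_eq, smul_smul, mul_inv_cancel₀ hi, one_smul] at h

end Hilbert

/-- If `T` satisfies the Diskcyclic Criterion and there is a normalized basic sequence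
`(u_m)` with `T u_m → 0`, then `T` has an infinite-dimensional closed subspace all of whose
nonzero elements are diskcyclic vectors. -/
theorem exists_infinite_dim_closed_diskcyclic_subspace_of_basic_seq {H : Type*}
    [NormedAddCommGroup H] [InnerProductSpace ℂ H] [CompleteSpace H]
    [TopologicalSpace.SeparableSpace H] (h_inf : ¬ FiniteDimensional ℂ H)
    (T : H →L[ℂ] H) (hT : SatisfiesDiskcyclicCriterion T)
    (u : ℕ → H) (hu_norm : ∀ m, ‖u m‖ = 1)
    (hu_basic : ∃ C : ℝ, 1 ≤ C ∧ ∀ (m p : ℕ), m ≤ p → ∀ a : ℕ → ℂ,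
      ‖∑ i ∈ Finset.range (m + 1), a i • u i‖ ≤ C * ‖∑ i ∈ Finset.range (p + 1), a i • u i‖)
    (hTu : Tendsto (fun m => T (u m)) atTop (𝓝 0)) :
    ∃ M : Submodule ℂ H, IsClosed (M : Set H) ∧ ¬ FiniteDimensional ℂ M ∧
      ∀ z ∈ M, z ≠ 0 → IsDiskcyclicVector T z := by
  obtain ⟨C, hC1, hC⟩ := hu_basic
  obtain ⟨X, hX, hXT⟩ := hT.exists_dense_forall_exists
  have : Nonempty H := ⟨0⟩
  let q := TopologicalSpace.denseSeq H
  let j : ℕ → ℕ := fun k => k.unpair.1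
  let m : ℕ → ℕ := fun k => k.unpair.2.unpair.1
  have hjm : ∀ a b, ∃ k : ℕ → ℕ, Tendsto k atTop atTop ∧ ∀ t, j (k t) = a ∧ m (k t) = b :=
    fun a b => ⟨fun t => Nat.pair a (Nat.pair b t),
      tendsto_atTop_mono (fun t => (Nat.right_le_pair b t).trans (Nat.right_le_pair a _))
        tendsto_id, fun t => by simp [j, m]⟩
  let ε : ℕ → ℝ := fun k => 1 / 8 * (1 / 2) ^ k
  have hε : HasSum ε (1 / 4) := by
    have h := hasSum_geometric_two.mul_left (1 / 8 : ℝ)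
    norm_num at h
    simpa [ε] using h
  have hanti : Antitone ε := fun i k hik =>
    mul_le_mul_of_nonneg_left (pow_le_pow_of_le_one (by norm_num) (by norm_num) hik) (by norm_num)
  obtain ⟨f, hf, hfc⟩ := exists_seq_of_forall_nat_finset_exists
    (fun k (p : DiskcyclicStage H) => p.IsGood T X (q (m k)) (ε k))
    (fun k p p' => p.IsCompatible T (ε k) p') fun k s hs =>
      exists_diskcyclicStage hX hXT
        (fun s U hU => exists_unit_orthogonal_map_mem_nhds hu_norm (by linarith)
          (fun _ _ => one_le_mul_norm_sub_of_basic_seq hu_norm hC) hTu s hU)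
        (q (m k)) (by positivity) s fun p hp => by
          obtain ⟨i, hi⟩ := hs p hp
          exact ⟨hi.n_pos, hi.x_mem, hi.v_mem⟩
  have ho : Orthonormal ℂ fun i => (f i).o := by
    refine ⟨fun i => (hf i).norm_o, fun i k hik => ?_⟩
    rcases hik.lt_or_gt with h | h
    · exact (hfc i k h).inner_eq_zero
    · exact inner_eq_zero_symm.1 (hfc k i h).inner_eq_zero
  obtain ⟨K, hK, hKs⟩ := ho.exists_perturbed_embedding (j := j)
    (fun i => (hf i).norm_v_sub_o) (fun i => (hf i).norm_x) hε
  have hKa : AntilipschitzWith 2 K := K.antilipschitz_of_bound hK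
  refine ⟨K.range, ?_, fun h => ?_, ?_⟩
  · rw [LinearMap.coe_range]
    exact hKa.isClosed_range K.uniformContinuous
  · exact not_finiteDimensional_lp_two_nat
      (LinearEquiv.ofInjective K.toLinearMap hKa.injective).symm.finiteDimensional
  · rintro _ ⟨a, rfl⟩ ha
    refine isDiskcyclicVector_of_stages (TopologicalSpace.denseRange_denseSeq H) hjm hanti hε hf hfc
      (a := a) (by rintro rfl; exact ha (map_zero K)) ?_
    simpa using hKs a
end
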